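/- arXiv:1506.02576 — 10 statements merged into one kernel-verified Lean document; each statement's English description precedes it below -/
import Mathlib

section
/- Let G be a connected claw-free graph that contains a peculiar graph as an induced subgraph, and assume G contains no induced cycle of length 5. Then G itself is peculiar. -/
open SimpleGraph

variable {V : Type*}

/-- An `L`-coloring: a proper vertex coloring `c` with `c v ∈ L v` for every vertex. -/
def ListColorable (G : SimpleGraph V) (L : V → Finset ℕ) : Prop :=
  ∃ c : V → ℕ, (∀ v, c v ∈ L v) ∧ ∀ ⦃u w : V⦄, G.Adj u w → c u ≠ c w

/-- `G` is `k`-choosable: `L`-colorable for every list assignment with lists of size `k`. -/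
def Choosable (G : SimpleGraph V) (k : ℕ) : Prop :=
  ∀ L : V → Finset ℕ, (∀ v, (L v).card = k) → ListColorable G L

/-- The choice number (list-chromatic number) of `G`. -/
noncomputable def choiceNumber (G : SimpleGraph V) : ℕ :=
  sInf {k | Choosable G k}

/-- The clique number of `G`. -/
noncomputable def cliqueNumber (G : SimpleGraph V) : ℕ :=
  sSup {n | ∃ s : Finset V, G.IsNClique n s}

/-- `G` has no induced claw (`K_{1,3}`). -/
def IsClawFree (G : SimpleGraph V) : Prop :=
  ∀ a b c d : V, G.Adj a b → G.Adj a c → G.Adj a d →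
    ¬G.Adj b c → ¬G.Adj b d → ¬G.Adj c d → b ≠ c → b ≠ d → c ≠ d → False

/-- `G` is perfect: every induced subgraph has chromatic number equal to clique number. -/
def IsPerfect (G : SimpleGraph V) : Prop :=
  ∀ s : Set V, (G.induce s).chromaticNumber = (cliqueNumber (G.induce s) : ℕ∞)

/-- `S` is complete to `T`: every vertex of `S` is adjacent to every vertex of `T`. -/
def IsCompleteTo (G : SimpleGraph V) (S T : Set V) : Prop :=
  ∀ ⦃s⦄, s ∈ S → ∀ ⦃t⦄, t ∈ T → G.Adj s t

/-- `S` is anticomplete to `T`: no vertex of `S` is adjacent to any vertex of `T`. -/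
def IsAnticompleteTo (G : SimpleGraph V) (S T : Set V) : Prop :=
  ∀ ⦃s⦄, s ∈ S → ∀ ⦃t⦄, t ∈ T → ¬G.Adj s t

/-- `(A, B, Q)` is a peculiar partition of `G` (indices mod 3). -/
structure IsPeculiarPartition (G : SimpleGraph V) (A B Q : Fin 3 → Set V) : Prop where
  cover : ∀ v : V, (∃ i, v ∈ A i) ∨ (∃ i, v ∈ B i) ∨ (∃ i, v ∈ Q i)
  pairwiseDisjoint :
    Pairwise (Function.onFun Disjoint (fun p : Fin 3 × Fin 3 => ![A, B, Q] p.1 p.2))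
  nonemptyA : ∀ i, (A i).Nonempty
  nonemptyB : ∀ i, (B i).Nonempty
  nonemptyQ : ∀ i, (Q i).Nonempty
  cliqueA : ∀ i, G.IsClique (A i)
  cliqueB : ∀ i, G.IsClique (B i)
  cliqueQ : ∀ i, G.IsClique (Q i)
  A_complete : ∀ i, IsCompleteTo G (A i) (B i ∪ A (i + 1) ∪ A (i + 2) ∪ B (i + 2))
  A_not_complete : ∀ i, ¬ IsCompleteTo G (A i) (B (i + 1))
  B_complete : ∀ i, IsCompleteTo G (B i) (A i ∪ B (i + 1) ∪ B (i + 2) ∪ A (i + 1))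
  B_not_complete : ∀ i, ¬ IsCompleteTo G (B i) (A (i + 2))
  Q_complete : ∀ i, IsCompleteTo G (Q i) (A (i + 1) ∪ B (i + 1) ∪ A (i + 2) ∪ B (i + 2))
  Q_anticomplete : ∀ i, IsAnticompleteTo G (Q i) (A i ∪ B i ∪ Q (i + 1) ∪ Q (i + 2))

/-- `G` is peculiar if it admits a peculiar partition. -/
def IsPeculiar (G : SimpleGraph V) : Prop :=
  ∃ A B Q : Fin 3 → Set V, IsPeculiarPartition G A B Q

/-- `G` is cobipartite: its vertex set is covered by at most two cliques. -/
def Cobipartite (G : SimpleGraph V) : Prop :=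
  ∃ S T : Set V, S ∪ T = Set.univ ∧ G.IsClique S ∧ G.IsClique T


/-- `G` contains an induced cycle of length 5. -/
def HasInducedC5 {V : Type*} (G : SimpleGraph V) : Prop :=
  ∃ f : Fin 5 → V, Function.Injective f ∧
    ∀ i j : Fin 5, G.Adj (f i) (f j) ↔ (j = i + 1 ∨ i = j + 1)

theorem c5_of {V : Type*} (G : SimpleGraph V) (a b c d e : V)
    (h1 : G.Adj a b) (h2 : G.Adj b c) (h3 : G.Adj c d) (h4 : G.Adj d e) (h5 : G.Adj e a)
    (n1 : ¬ G.Adj a c) (n2 : ¬ G.Adj a d) (n3 : ¬ G.Adj b d) (n4 : ¬ G.Adj b e)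
    (n5 : ¬ G.Adj c e) : HasInducedC5 G := by
  have key : ∀ i j : Fin 5, G.Adj (![a, b, c, d, e] i) (![a, b, c, d, e] j) ↔
      (j = i + 1 ∨ i = j + 1) := by
    intro i j
    fin_cases i <;> fin_cases j <;>
      simp [h1, h2, h3, h4, h5, n1, n2, n3, n4, n5, h1.symm, h2.symm, h3.symm, h4.symm, h5.symm,
        G.adj_comm c a, G.adj_comm d a, G.adj_comm d b, G.adj_comm e b, G.adj_comm e c]
  refine ⟨![a, b, c, d, e], ?_, key⟩
  intro i j hij
  have hk : ∀ k : Fin 5, (k = i + 1 ∨ i = k + 1) ↔ (k = j + 1 ∨ j = k + 1) := by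
    intro k
    rw [← key i k, ← key j k, hij]
  clear hij key
  revert i j
  decide

/-- Symmetric description of peculiar structure inside `G`. -/
structure Wk {V : Type*} (G : SimpleGraph V) (C1 C2 C3 Q1 Q2 Q3 : Set V) : Prop where
  c1 : ∀ x ∈ C1, ∀ y ∈ C1, x ≠ y → G.Adj x y
  c2 : ∀ x ∈ C2, ∀ y ∈ C2, x ≠ y → G.Adj x y
  c3 : ∀ x ∈ C3, ∀ y ∈ C3, x ≠ y → G.Adj x y
  k1 : ∀ x ∈ Q1, ∀ y ∈ Q1, x ≠ y → G.Adj x y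
  k2 : ∀ x ∈ Q2, ∀ y ∈ Q2, x ≠ y → G.Adj x y
  k3 : ∀ x ∈ Q3, ∀ y ∈ Q3, x ≠ y → G.Adj x y
  n1 : ∃ x, x ∈ Q1
  n2 : ∃ x, x ∈ Q2
  n3 : ∃ x, x ∈ Q3
  q12 : ∀ x ∈ Q1, ∀ y ∈ C2, G.Adj x y
  q13 : ∀ x ∈ Q1, ∀ y ∈ C3, G.Adj x y
  q21 : ∀ x ∈ Q2, ∀ y ∈ C1, G.Adj x y
  q23 : ∀ x ∈ Q2, ∀ y ∈ C3, G.Adj x y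
  q31 : ∀ x ∈ Q3, ∀ y ∈ C1, G.Adj x y
  q32 : ∀ x ∈ Q3, ∀ y ∈ C2, G.Adj x y
  a1 : ∀ x ∈ Q1, ∀ y ∈ C1, ¬ G.Adj x y
  a2 : ∀ x ∈ Q2, ∀ y ∈ C2, ¬ G.Adj x y
  a3 : ∀ x ∈ Q3, ∀ y ∈ C3, ¬ G.Adj x y
  a12 : ∀ x ∈ Q1, ∀ y ∈ Q2, ¬ G.Adj x y
  a13 : ∀ x ∈ Q1, ∀ y ∈ Q3, ¬ G.Adj x y
  a23 : ∀ x ∈ Q2, ∀ y ∈ Q3, ¬ G.Adj x y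
  s1 : ∀ x ∈ C1, ∀ y ∈ C2, ∀ z ∈ C3, G.Adj x y ∨ G.Adj x z
  s2 : ∀ x ∈ C2, ∀ y ∈ C1, ∀ z ∈ C3, G.Adj x y ∨ G.Adj x z
  s3 : ∀ x ∈ C3, ∀ y ∈ C1, ∀ z ∈ C2, G.Adj x y ∨ G.Adj x z
  e12 : ∃ x ∈ C1, ∃ y ∈ C2, ¬ G.Adj x y
  e13 : ∃ x ∈ C1, ∃ y ∈ C3, ¬ G.Adj x y
  e23 : ∃ x ∈ C2, ∃ y ∈ C3, ¬ G.Adj x y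
  d12 : ∀ x ∈ C1, x ∉ C2
  d13 : ∀ x ∈ C1, x ∉ C3
  d23 : ∀ x ∈ C2, x ∉ C3
  g1 : ∀ x ∈ C1, x ∉ Q1
  g2 : ∀ x ∈ C2, x ∉ Q2
  g3 : ∀ x ∈ C3, x ∉ Q3
  f12 : ∀ x ∈ Q1, x ∉ Q2
  f13 : ∀ x ∈ Q1, x ∉ Q3
  f23 : ∀ x ∈ Q2, x ∉ Q3

section Wk
variable {V : Type*} {G : SimpleGraph V} {C1 C2 C3 Q1 Q2 Q3 : Set V}

/-- Swap indices 2 and 3. -/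
theorem Wk.swap (h : Wk G C1 C2 C3 Q1 Q2 Q3) : Wk G C1 C3 C2 Q1 Q3 Q2 := by
  have sym : ∀ a b, G.Adj a b → G.Adj b a := fun a b h => h.symm
  obtain ⟨⟩ := h
  constructor <;> first | assumption | grind

/-- Rotate the indices. -/
theorem Wk.rot (h : Wk G C1 C2 C3 Q1 Q2 Q3) : Wk G C2 C3 C1 Q2 Q3 Q1 := by
  have sym : ∀ a b, G.Adj a b → G.Adj b a := fun a b h => h.symm
  obtain ⟨⟩ := h
  constructor <;> first | assumption | grind

def un (C1 C2 C3 Q1 Q2 Q3 : Set V) : Set V := C1 ∪ C2 ∪ C3 ∪ Q1 ∪ Q2 ∪ Q3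

theorem mem_un {x : V} : x ∈ un C1 C2 C3 Q1 Q2 Q3 ↔
    x ∈ C1 ∨ x ∈ C2 ∨ x ∈ C3 ∨ x ∈ Q1 ∨ x ∈ Q2 ∨ x ∈ Q3 := by
  simp only [un, Set.mem_union]; tauto

/-- Claw-freeness, leaves are distinguished automatically from an outside vertex. -/
theorem claw' (hclaw : IsClawFree G) {S : Set V} {v x y z : V} (hv : v ∉ S) (hy : y ∈ S)
    (hz : z ∈ S) (hyz : y ≠ z) (h1 : G.Adj x v) (h2 : G.Adj x y) (h3 : G.Adj x z)
    (n1 : ¬ G.Adj v y) (n2 : ¬ G.Adj y z) : G.Adj v z := by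
  by_contra n3
  exact hclaw x v y z h1 h2 h3 n1 n3 n2 (fun h => hv (h ▸ hy)) (fun h => hv (h ▸ hz)) hyz

variable {v : V}

theorem Wk.caseQ (h : Wk G C1 C2 C3 Q1 Q2 Q3) (hclaw : IsClawFree G)
    (hv : v ∉ un C1 C2 C3 Q1 Q2 Q3) (hn : ∃ u ∈ un C1 C2 C3 Q1 Q2 Q3, G.Adj v u)
    (h2 : ∀ q ∈ Q2, ¬ G.Adj v q) (h3 : ∀ q ∈ Q3, ¬ G.Adj v q) :
    Wk G C1 C2 C3 (insert v Q1) Q2 Q3 := by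
  have sym : ∀ a b, G.Adj a b → G.Adj b a := fun a b h => h.symm
  obtain ⟨p1, hp1⟩ := h.n1
  obtain ⟨p2, hp2⟩ := h.n2
  obtain ⟨p3, hp3⟩ := h.n3
  have m := @mem_un V C1 C2 C3 Q1 Q2 Q3
  have A1 : ∀ x ∈ C1, ¬ G.Adj v x := by
    intro x hx hvx
    exact h3 p3 hp3 (claw' hclaw (x := x) hv (m.2 (by tauto)) (m.2 (by tauto))
      (fun e : p2 = p3 => h.f23 p2 hp2 (e ▸ hp3)) hvx.symm (h.q21 _ hp2 _ hx).symm (h.q31 _ hp3 _ hx).symm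
      (h2 p2 hp2) (h.a23 _ hp2 _ hp3))
  have P2 : ∀ x ∈ C3, G.Adj v x → ∀ y ∈ C2, G.Adj x y → G.Adj v y := by
    intro x hx hvx y hy hxy
    exact (claw' hclaw (x := x) hv (m.2 (by tauto)) (m.2 (by tauto))
      (fun e => h.g2 y hy (e ▸ hp2)) hvx.symm (h.q23 _ hp2 _ hx).symm hxy
      (h2 p2 hp2) (h.a2 _ hp2 _ hy))
  have P3 : ∀ x ∈ C2, G.Adj v x → ∀ y ∈ C3, G.Adj x y → G.Adj v y := by
    intro x hx hvx y hy hxy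
    exact (claw' hclaw (x := x) hv (m.2 (by tauto)) (m.2 (by tauto))
      (fun e => h.g3 y hy (e ▸ hp3)) hvx.symm (h.q32 _ hp3 _ hx).symm hxy
      (h3 p3 hp3) (h.a3 _ hp3 _ hy))
  obtain ⟨x1, hx1, x2, hx2, nx⟩ := h.e12
  obtain ⟨y1, hy1, y3, hy3, ny⟩ := h.e13
  obtain ⟨z2, hz2, z3, hz3, nz⟩ := h.e23
  have X : ∀ y ∈ C3, G.Adj x2 y := fun y hy =>
    (h.s2 x2 hx2 x1 hx1 y hy).resolve_left (fun e => nx e.symm)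
  have Y : ∀ y ∈ C2, G.Adj y3 y := fun y hy =>
    (h.s3 y3 hy3 y1 hy1 y hy).resolve_left (fun e => ny e.symm)
  have full : (∃ x ∈ C2, G.Adj v x) → (∀ x ∈ C2, G.Adj v x) ∧ (∀ x ∈ C3, G.Adj v x) := by
    rintro ⟨x, hx, hvx⟩
    have t1 := P3 x hx hvx y3 hy3 (Y x hx).symm
    have t2 : ∀ x ∈ C2, G.Adj v x := fun y hy => P2 y3 hy3 t1 y hy (Y y hy)
    exact ⟨t2, fun y hy => P3 x2 hx2 (t2 _ hx2) y hy (X y hy)⟩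
  have ex2 : ∃ x ∈ C2, G.Adj v x := by
    by_contra! no
    have no3 : ∀ y ∈ C3, ¬ G.Adj v y := fun y hy hvy =>
      no x2 hx2 (P2 y hy hvy x2 hx2 (X y hy).symm)
    obtain ⟨u, hu, hvu⟩ := hn
    have hu1 : u ∈ Q1 := by
      have := m.1 hu
      grind
    exact no3 z3 hz3 (claw' hclaw (x := u) hv (m.2 (by tauto)) (m.2 (by tauto))
      (fun e : z2 = z3 => h.d23 z2 hz2 (e ▸ hz3)) hvu.symm (h.q12 _ hu1 _ hz2) (h.q13 _ hu1 _ hz3)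
      (no z2 hz2) nz)
  obtain ⟨F2, F3⟩ := full ex2
  have F1 : ∀ q ∈ Q1, G.Adj v q := by
    intro q hq
    exact (claw' hclaw (x := x2) hv (m.2 (by tauto)) (m.2 (by tauto))
      (fun e => h.f13 q hq (e ▸ hp3)) (F2 x2 hx2).symm (h.q32 _ hp3 _ hx2).symm
      (h.q12 _ hq _ hx2).symm
      (h3 p3 hp3) (fun e => h.a13 _ hq _ hp3 e.symm))
  rw [m] at hv
  obtain ⟨⟩ := h
  clear P2 P3 X Y full hn m hclaw
  constructor <;> first | assumption | (simp only [Set.mem_insert_iff]; grind)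

theorem Wk.C_aux (h : Wk G C1 C2 C3 Q1 Q2 Q3) (hclaw : IsClawFree G)
    (hv : v ∉ un C1 C2 C3 Q1 Q2 Q3)
    (h1 : ∀ q ∈ Q1, ¬ G.Adj v q)
    {q2 : V} (hq2 : q2 ∈ Q2) (hv2 : G.Adj v q2)
    {x : V} (hx : x ∈ C1) (hx3 : ∀ y ∈ C3, G.Adj x y) : G.Adj v x := by
  by_contra hvx
  have m := @mem_un V C1 C2 C3 Q1 Q2 Q3
  obtain ⟨p1, hp1⟩ := h.n1
  have P3 : ∀ y ∈ C3, ¬ G.Adj v y := by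
    intro y hy hvy
    exact hvx (claw' hclaw (x := y) hv (m.2 (by tauto)) (m.2 (by tauto))
      (fun e => h.g1 x hx (e ▸ hp1)) hvy.symm (h.q13 _ hp1 _ hy).symm (hx3 y hy).symm
      (h1 p1 hp1) (h.a1 _ hp1 _ hx))
  have P2 : ∀ y ∈ C2, G.Adj x y → ¬ G.Adj v y := by
    intro y hy hxy hvy
    exact hvx (claw' hclaw (x := y) hv (m.2 (by tauto)) (m.2 (by tauto))
      (fun e => h.g1 x hx (e ▸ hp1)) hvy.symm (h.q12 _ hp1 _ hy).symm hxy.symm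
      (h1 p1 hp1) (h.a1 _ hp1 _ hx))
  obtain ⟨y1, hy1, y3, hy3, ny⟩ := h.e13
  obtain ⟨z2, hz2, z3, hz3, nz⟩ := h.e23
  have t : G.Adj v y1 := claw' hclaw (x := q2) hv (m.2 (by tauto)) (m.2 (by tauto))
      (fun e => h.d13 y1 hy1 (e ▸ hy3)) hv2.symm (h.q23 _ hq2 _ hy3) (h.q21 _ hq2 _ hy1)
      (P3 y3 hy3) (fun e => ny e.symm)
  have Z2 : ∀ y ∈ C1, G.Adj z2 y := fun y hy =>
    (h.s2 z2 hz2 y hy z3 hz3).resolve_right nz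
  have Z3 : ∀ y ∈ C1, G.Adj z3 y := fun y hy =>
    (h.s3 z3 hz3 y hy z2 hz2).resolve_right (fun e => nz e.symm)
  exact P3 z3 hz3 (claw' hclaw (x := y1) hv (m.2 (by tauto)) (m.2 (by tauto))
      (fun e : z2 = z3 => h.d23 z2 hz2 (e ▸ hz3)) t.symm (Z2 y1 hy1).symm (Z3 y1 hy1).symm
      (P2 z2 hz2 (Z2 x hx).symm) nz)

theorem Wk.Q_aux (h : Wk G C1 C2 C3 Q1 Q2 Q3) (hclaw : IsClawFree G) (hC5 : ¬ HasInducedC5 G)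
    (hv : v ∉ un C1 C2 C3 Q1 Q2 Q3)
    (h1 : ∀ q ∈ Q1, ¬ G.Adj v q)
    {q2 : V} (hq2 : q2 ∈ Q2) (hv2 : G.Adj v q2) (hC : ∀ x ∈ C1, G.Adj v x)
    {q : V} (hq : q ∈ Q2) : G.Adj v q := by
  by_contra hvq
  have m := @mem_un V C1 C2 C3 Q1 Q2 Q3
  obtain ⟨p1, hp1⟩ := h.n1
  obtain ⟨y1, hy1, y3, hy3, ny⟩ := h.e13
  obtain ⟨z2, hz2, z3, hz3, nz⟩ := h.e23
  have F2 : ∀ x ∈ C2, G.Adj v x := by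
    intro x hx
    have t := (h.s1 y1 hy1 x hx y3 hy3).resolve_right ny
    exact claw' hclaw (x := y1) hv (m.2 (by tauto)) (m.2 (by tauto))
      (fun e => h.g2 x hx (e ▸ hq)) (hC y1 hy1).symm (h.q21 _ hq _ hy1).symm t hvq
      (h.a2 _ hq _ hx)
  have F3 : ∀ x ∈ C3, ¬ G.Adj v x := by
    intro x hx hvx
    exact h1 p1 hp1 (claw' hclaw (x := x) hv (m.2 (by tauto)) (m.2 (by tauto))
      (fun e => h.f12 p1 hp1 (e ▸ hq)) hvx.symm (h.q23 _ hq _ hx).symm (h.q13 _ hp1 _ hx).symm hvq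
      (fun e => h.a12 _ hp1 _ hq e.symm))
  exact hC5 (c5_of G v q2 z3 p1 z2 hv2 (h.q23 _ hq2 _ hz3) (h.q13 _ hp1 _ hz3).symm
    (h.q12 _ hp1 _ hz2) (F2 z2 hz2).symm (F3 z3 hz3) (h1 p1 hp1)
    (fun e => h.a12 _ hp1 _ hq2 e.symm) (h.a2 _ hq2 _ hz2) (fun e => nz e.symm))

/-- `x ∈ C2` not adjacent to `v` is complete to `C3`. -/
theorem Wk.S_aux (h : Wk G C1 C2 C3 Q1 Q2 Q3) (hclaw : IsClawFree G) (hC5 : ¬ HasInducedC5 G)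
    (hv : v ∉ un C1 C2 C3 Q1 Q2 Q3)
    (h1 : ∀ q ∈ Q1, ¬ G.Adj v q) (hC : ∀ x ∈ C1, G.Adj v x)
    (H3 : ∀ q ∈ Q3, G.Adj v q)
    {x y : V} (hx : x ∈ C2) (hy : y ∈ C3) (hvx : ¬ G.Adj v x) : G.Adj x y := by
  by_contra nxy
  have m := @mem_un V C1 C2 C3 Q1 Q2 Q3
  obtain ⟨p1, hp1⟩ := h.n1
  obtain ⟨p3, hp3⟩ := h.n3
  obtain ⟨w, hw, -⟩ := h.e12
  have t2 := (h.s2 x hx w hw y hy).resolve_right nxy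
  have t3 := (h.s3 y hy w hw x hx).resolve_right (fun e => nxy e.symm)
  have t : G.Adj v y := claw' hclaw (x := w) hv (m.2 (by tauto)) (m.2 (by tauto))
      (fun e : x = y => h.d23 x hx (e ▸ hy)) (hC w hw).symm t2.symm t3.symm hvx nxy
  exact hC5 (c5_of G v y p1 x p3 t (h.q13 _ hp1 _ hy).symm (h.q12 _ hp1 _ hx)
    (h.q32 _ hp3 _ hx).symm (H3 p3 hp3).symm (h1 p1 hp1) hvx (fun e => nxy e.symm)
    (fun e => h.a3 _ hp3 _ hy e.symm) (h.a13 _ hp1 _ hp3))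

theorem un_swap : un C1 C3 C2 Q1 Q3 Q2 = un C1 C2 C3 Q1 Q2 Q3 := by
  ext x; simp only [mem_un]; tauto

theorem un_rot : un C2 C3 C1 Q2 Q3 Q1 = un C1 C2 C3 Q1 Q2 Q3 := by
  ext x; simp only [mem_un]; tauto

theorem Wk.caseC (h : Wk G C1 C2 C3 Q1 Q2 Q3) (hclaw : IsClawFree G) (hC5 : ¬ HasInducedC5 G)
    (hv : v ∉ un C1 C2 C3 Q1 Q2 Q3)
    (h2 : ∃ q ∈ Q2, G.Adj v q) (h3 : ∃ q ∈ Q3, G.Adj v q) :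
    Wk G (insert v C1) C2 C3 Q1 Q2 Q3 := by
  have sym : ∀ a b, G.Adj a b → G.Adj b a := fun a b h => h.symm
  obtain ⟨q2, hq2, hv2⟩ := h2
  obtain ⟨q3, hq3, hv3⟩ := h3
  have m := @mem_un V C1 C2 C3 Q1 Q2 Q3
  have hv' : v ∉ un C1 C3 C2 Q1 Q3 Q2 := by rwa [un_swap]
  have h1 : ∀ q ∈ Q1, ¬ G.Adj v q := by
    intro q hq hvq
    exact hclaw v q q2 q3 hvq hv2 hv3 (h.a12 _ hq _ hq2) (h.a13 _ hq _ hq3) (h.a23 _ hq2 _ hq3)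
      (fun e => h.f12 q hq (e ▸ hq2)) (fun e => h.f13 q hq (e ▸ hq3))
      (fun e => h.f23 q2 hq2 (e ▸ hq3))
  have F1 : ∀ x ∈ C1, G.Adj v x := by
    intro x hx
    by_cases hh : ∀ y ∈ C3, G.Adj x y
    · exact h.C_aux hclaw hv h1 hq2 hv2 hx hh
    · push Not at hh
      obtain ⟨y, hy, nxy⟩ := hh
      exact h.swap.C_aux hclaw hv' h1 hq3 hv3 hx
        (fun z hz => (h.s1 x hx z hz y hy).resolve_right nxy)
  have H2 : ∀ q ∈ Q2, G.Adj v q := fun q hq => h.Q_aux hclaw hC5 hv h1 hq2 hv2 F1 hq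
  have H3 : ∀ q ∈ Q3, G.Adj v q := fun q hq => h.swap.Q_aux hclaw hC5 hv' h1 hq3 hv3 F1 hq
  have S2 : ∀ x ∈ C2, ∀ y ∈ C3, ¬ G.Adj v x → G.Adj x y := fun x hx y hy hvx =>
    h.S_aux hclaw hC5 hv h1 F1 H3 hx hy hvx
  have S3 : ∀ x ∈ C3, ∀ y ∈ C2, ¬ G.Adj v x → G.Adj x y := fun x hx y hy hvx =>
    h.swap.S_aux hclaw hC5 hv' h1 F1 H2 hx hy hvx
  have S1 : ∀ x ∈ C2, ∀ y ∈ C3, G.Adj v x ∨ G.Adj v y := by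
    intro x hx y hy
    by_contra! hh
    exact hC5 (c5_of G v q2 y x q3 hv2 (h.q23 _ hq2 _ hy) (S2 x hx y hy hh.1).symm
      (h.q32 _ hq3 _ hx).symm hv3.symm hh.2 hh.1 (h.a2 _ hq2 _ hx) (h.a23 _ hq2 _ hq3)
      (fun e => h.a3 _ hq3 _ hy e.symm))
  have E12 : ∃ x ∈ insert v C1, ∃ y ∈ C2, ¬ G.Adj x y := by
    obtain ⟨x, hx, y, hy, n⟩ := h.e12
    exact ⟨x, Set.mem_insert_of_mem _ hx, y, hy, n⟩
  have E13 : ∃ x ∈ insert v C1, ∃ y ∈ C3, ¬ G.Adj x y := by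
    obtain ⟨x, hx, y, hy, n⟩ := h.e13
    exact ⟨x, Set.mem_insert_of_mem _ hx, y, hy, n⟩
  rw [m] at hv
  obtain ⟨⟩ := h
  clear m hclaw hC5 hv'
  constructor <;> first | assumption | (simp only [Set.mem_insert_iff]; grind)

theorem un_insC : un (insert v C1) C2 C3 Q1 Q2 Q3 = insert v (un C1 C2 C3 Q1 Q2 Q3) := by
  ext x; simp only [mem_un, Set.mem_insert_iff, or_assoc]

theorem un_insQ : un C1 C2 C3 (insert v Q1) Q2 Q3 = insert v (un C1 C2 C3 Q1 Q2 Q3) := by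
  ext x; simp only [mem_un, Set.mem_insert_iff]; tauto

theorem Wk.extend (h : Wk G C1 C2 C3 Q1 Q2 Q3) (hclaw : IsClawFree G) (hC5 : ¬ HasInducedC5 G)
    (hv : v ∉ un C1 C2 C3 Q1 Q2 Q3) (hn : ∃ u ∈ un C1 C2 C3 Q1 Q2 Q3, G.Adj v u) :
    ∃ D1 D2 D3 P1 P2 P3, Wk G D1 D2 D3 P1 P2 P3 ∧
      un D1 D2 D3 P1 P2 P3 = insert v (un C1 C2 C3 Q1 Q2 Q3) := by
  have hv' : v ∉ un C2 C3 C1 Q2 Q3 Q1 := by rwa [un_rot]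
  have hv'' : v ∉ un C3 C1 C2 Q3 Q1 Q2 := by rwa [un_rot, un_rot]
  have hn' : ∃ u ∈ un C2 C3 C1 Q2 Q3 Q1, G.Adj v u := by rwa [un_rot]
  have hn'' : ∃ u ∈ un C3 C1 C2 Q3 Q1 Q2, G.Adj v u := by rwa [un_rot, un_rot]
  have e1 : ∀ Q : Set V, (∀ q ∈ Q, ¬ G.Adj v q) ∨ (∃ q ∈ Q, G.Adj v q) := by
    intro Q; by_cases hh : ∃ q ∈ Q, G.Adj v q
    · exact Or.inr hh
    · left; push Not at hh; exact hh
  rcases e1 Q1 with a1 | b1 <;> rcases e1 Q2 with a2 | b2 <;> rcases e1 Q3 with a3 | b3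
  · exact ⟨_, _, _, _, _, _, h.caseQ hclaw hv hn a2 a3, by rw [un_insQ]⟩
  · exact ⟨_, _, _, _, _, _, h.rot.rot.caseQ hclaw hv'' hn'' a1 a2, by rw [un_insQ, un_rot, un_rot]⟩
  · exact ⟨_, _, _, _, _, _, h.rot.caseQ hclaw hv' hn' a3 a1, by rw [un_insQ, un_rot]⟩
  · exact ⟨_, _, _, _, _, _, h.caseC hclaw hC5 hv b2 b3, by rw [un_insC]⟩
  · exact ⟨_, _, _, _, _, _, h.caseQ hclaw hv hn a2 a3, by rw [un_insQ]⟩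
  · exact ⟨_, _, _, _, _, _, h.rot.caseC hclaw hC5 hv' b3 b1, by rw [un_insC, un_rot]⟩
  · exact ⟨_, _, _, _, _, _, h.rot.rot.caseC hclaw hC5 hv'' b1 b2, by rw [un_insC, un_rot, un_rot]⟩
  · exact ⟨_, _, _, _, _, _, h.caseC hclaw hC5 hv b2 b3, by rw [un_insC]⟩

set_option maxHeartbeats 4000000 in
theorem Wk.peculiar (h : Wk G C1 C2 C3 Q1 Q2 Q3) (hu : un C1 C2 C3 Q1 Q2 Q3 = Set.univ) :
    IsPeculiar G := by
  have sym : ∀ a b, G.Adj a b → G.Adj b a := fun a b h => h.symm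
  have irr : ∀ a, ¬ G.Adj a a := fun a => G.irrefl
  have m : ∀ x, x ∈ C1 ∨ x ∈ C2 ∨ x ∈ C3 ∨ x ∈ Q1 ∨ x ∈ Q2 ∨ x ∈ Q3 := fun x =>
    mem_un.1 (hu ▸ Set.mem_univ x)
  obtain ⟨A1, hA1⟩ : ∃ A : Set V, ∀ x, x ∈ A ↔ x ∈ C1 ∧ ∃ y ∈ C2, ¬ G.Adj x y :=
    ⟨{x | _}, fun x => Iff.rfl⟩
  obtain ⟨A2, hA2⟩ : ∃ A : Set V, ∀ x, x ∈ A ↔ x ∈ C2 ∧ ∃ y ∈ C3, ¬ G.Adj x y :=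
    ⟨{x | _}, fun x => Iff.rfl⟩
  obtain ⟨A3, hA3⟩ : ∃ A : Set V, ∀ x, x ∈ A ↔ x ∈ C3 ∧ ∃ y ∈ C1, ¬ G.Adj x y :=
    ⟨{x | _}, fun x => Iff.rfl⟩
  obtain ⟨B1, hB1⟩ : ∃ A : Set V, ∀ x, x ∈ A ↔ x ∈ C1 ∧ ∀ y ∈ C2, G.Adj x y :=
    ⟨{x | _}, fun x => Iff.rfl⟩
  obtain ⟨B2, hB2⟩ : ∃ A : Set V, ∀ x, x ∈ A ↔ x ∈ C2 ∧ ∀ y ∈ C3, G.Adj x y :=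
    ⟨{x | _}, fun x => Iff.rfl⟩
  obtain ⟨B3, hB3⟩ : ∃ A : Set V, ∀ x, x ∈ A ↔ x ∈ C3 ∧ ∀ y ∈ C1, G.Adj x y :=
    ⟨{x | _}, fun x => Iff.rfl⟩
  have E1 : ∃ x ∈ A1, ∃ y ∈ B2, ¬ G.Adj x y := by
    obtain ⟨x, hx, y, hy, n⟩ := h.e12
    refine ⟨x, (hA1 x).2 ⟨hx, y, hy, n⟩, y, (hB2 y).2 ⟨hy, fun z hz => ?_⟩, n⟩
    exact (h.s2 y hy x hx z hz).resolve_left (fun e => n e.symm)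
  have E2 : ∃ x ∈ A2, ∃ y ∈ B3, ¬ G.Adj x y := by
    obtain ⟨x, hx, y, hy, n⟩ := h.e23
    refine ⟨x, (hA2 x).2 ⟨hx, y, hy, n⟩, y, (hB3 y).2 ⟨hy, fun z hz => ?_⟩, n⟩
    exact (h.s3 y hy z hz x hx).resolve_right (fun e => n e.symm)
  have E3 : ∃ x ∈ A3, ∃ y ∈ B1, ¬ G.Adj x y := by
    obtain ⟨y, hy, x, hx, n⟩ := h.e13
    refine ⟨x, (hA3 x).2 ⟨hx, y, hy, fun e => n e.symm⟩, y, (hB1 y).2 ⟨hy, fun z hz => ?_⟩,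
      fun e => n e.symm⟩
    exact (h.s1 y hy z hz x hx).resolve_right n
  have l1 : ∀ x ∈ A1, x ∈ C1 := fun x hx => ((hA1 x).1 hx).1
  have l2 : ∀ x ∈ A2, x ∈ C2 := fun x hx => ((hA2 x).1 hx).1
  have l3 : ∀ x ∈ A3, x ∈ C3 := fun x hx => ((hA3 x).1 hx).1
  have r1 : ∀ x ∈ B1, x ∈ C1 := fun x hx => ((hB1 x).1 hx).1
  have r2 : ∀ x ∈ B2, x ∈ C2 := fun x hx => ((hB2 x).1 hx).1
  have r3 : ∀ x ∈ B3, x ∈ C3 := fun x hx => ((hB3 x).1 hx).1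
  have t1 : ∀ x ∈ A1, ∀ z ∈ C3, G.Adj x z := fun x hx z hz => by
    obtain ⟨hc, y, hy, n⟩ := (hA1 x).1 hx
    exact (h.s1 x hc y hy z hz).resolve_left n
  have t2 : ∀ x ∈ A2, ∀ z ∈ C1, G.Adj x z := fun x hx z hz => by
    obtain ⟨hc, y, hy, n⟩ := (hA2 x).1 hx
    exact (h.s2 x hc z hz y hy).resolve_right n
  have t3 : ∀ x ∈ A3, ∀ z ∈ C2, G.Adj x z := fun x hx z hz => by
    obtain ⟨hc, y, hy, n⟩ := (hA3 x).1 hx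
    exact (h.s3 x hc y hy z hz).resolve_left n
  have u1 : ∀ x ∈ B1, ∀ z ∈ C2, G.Adj x z := fun x hx => ((hB1 x).1 hx).2
  have u2 : ∀ x ∈ B2, ∀ z ∈ C3, G.Adj x z := fun x hx => ((hB2 x).1 hx).2
  have u3 : ∀ x ∈ B3, ∀ z ∈ C1, G.Adj x z := fun x hx => ((hB3 x).1 hx).2
  have j1 : ∀ x ∈ A1, x ∉ B1 := fun x hx hy => by
      obtain ⟨-, y, hy', n⟩ := (hA1 x).1 hx
      exact n (((hB1 x).1 hy).2 y hy')
  have j2 : ∀ x ∈ A2, x ∉ B2 := fun x hx hy => by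
      obtain ⟨-, y, hy', n⟩ := (hA2 x).1 hx
      exact n (((hB2 x).1 hy).2 y hy')
  have j3 : ∀ x ∈ A3, x ∉ B3 := fun x hx hy => by
      obtain ⟨-, y, hy', n⟩ := (hA3 x).1 hx
      exact n (((hB3 x).1 hy).2 y hy')
  have D : Pairwise (Function.onFun Disjoint
      (fun p : Fin 3 × Fin 3 => ![![A1, A2, A3], ![B1, B2, B3], ![Q1, Q2, Q3]] p.1 p.2)) := by
    have i12 : ∀ x ∈ C2, x ∉ Q1 := fun x hx hq => irr _ (h.q12 x hq x hx)
    have i13 : ∀ x ∈ C3, x ∉ Q1 := fun x hx hq => irr _ (h.q13 x hq x hx)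
    have i21 : ∀ x ∈ C1, x ∉ Q2 := fun x hx hq => irr _ (h.q21 x hq x hx)
    have i23 : ∀ x ∈ C3, x ∉ Q2 := fun x hx hq => irr _ (h.q23 x hq x hx)
    have i31 : ∀ x ∈ C1, x ∉ Q3 := fun x hx hq => irr _ (h.q31 x hq x hx)
    have i32 : ∀ x ∈ C2, x ∉ Q3 := fun x hx hq => irr _ (h.q32 x hq x hx)
    have d12 := h.d12
    have d13 := h.d13
    have d23 := h.d23
    have g1 := h.g1
    have g2 := h.g2
    have g3 := h.g3
    have f12 := h.f12
    have f13 := h.f13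
    have f23 := h.f23
    clear hA1 hA2 hA3 hB1 hB2 hB3 t1 t2 t3 u1 u2 u3 E1 E2 E3 m sym irr h hu
    rintro ⟨i, j⟩ ⟨k, l⟩ hne
    simp only [Function.onFun, Set.disjoint_left]
    fin_cases i <;> fin_cases j <;> fin_cases k <;> fin_cases l <;>
      first
      | exact absurd rfl hne
      | (clear hne; simp; grind)
  cases h with
  | mk c1 c2 c3 k1 k2 k3 n1 n2 n3 q12 q13 q21 q23 q31 q32 a1 a2 a3 a12 a13 a23 s1 s2 s3 e12 e13 e23 d12 d13 d23 g1 g2 g3 f12 f13 f23 =>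
  have nA1 : ∀ x ∈ C1, x ∉ B1 → x ∈ A1 := by
    intro x hx hb
    by_contra ha
    refine hb ((hB1 x).2 ⟨hx, fun y hy => ?_⟩)
    by_contra n
    exact ha ((hA1 x).2 ⟨hx, y, hy, n⟩)
  have nA2 : ∀ x ∈ C2, x ∉ B2 → x ∈ A2 := by
    intro x hx hb
    by_contra ha
    refine hb ((hB2 x).2 ⟨hx, fun y hy => ?_⟩)
    by_contra n
    exact ha ((hA2 x).2 ⟨hx, y, hy, n⟩)
  have nA3 : ∀ x ∈ C3, x ∉ B3 → x ∈ A3 := by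
    intro x hx hb
    by_contra ha
    refine hb ((hB3 x).2 ⟨hx, fun y hy => ?_⟩)
    by_contra n
    exact ha ((hA3 x).2 ⟨hx, y, hy, n⟩)
  refine ⟨![A1, A2, A3], ![B1, B2, B3], ![Q1, Q2, Q3], ?_, ?_, ?_, ?_, ?_, ?_, ?_, ?_, ?_, ?_, ?_,
    ?_, ?_, ?_⟩
  · intro v
    simp [Fin.exists_fin_succ]
    clear hA1 hA2 hA3 hB1 hB2 hB3 E1 E2 E3
    rcases m v with hh | hh | hh | hh | hh | hh
    · by_cases hb : v ∈ B1
      · tauto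
      · have := nA1 v hh hb; tauto
    · by_cases hb : v ∈ B2
      · tauto
      · have := nA2 v hh hb; tauto
    · by_cases hb : v ∈ B3
      · tauto
      · have := nA3 v hh hb; tauto
    all_goals tauto
  · exact D
  · obtain ⟨x, hx, -⟩ := E1
    obtain ⟨y, hy, -⟩ := E2
    obtain ⟨z, hz, -⟩ := E3
    intro i
    fin_cases i
    exacts [⟨x, hx⟩, ⟨y, hy⟩, ⟨z, hz⟩]
  · obtain ⟨-, -, x, hx, -⟩ := E1
    obtain ⟨-, -, y, hy, -⟩ := E2
    obtain ⟨-, -, z, hz, -⟩ := E3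
    intro i
    fin_cases i
    exacts [⟨z, hz⟩, ⟨x, hx⟩, ⟨y, hy⟩]
  · intro i
    fin_cases i
    exacts [n1, n2, n3]
  all_goals clear D hA1 hA2 hA3 hB1 hB2 hB3 s1 s2 s3 e12 e13 e23 m hu d12 d13 d23 g1 g2 g3
  all_goals clear f12 f13 f23 nA1 nA2 nA3 n1 n2 n3
  rotate_left 4
  · obtain ⟨x1, hx1, y1, hy1, o1⟩ := E1
    obtain ⟨x2, hx2, y2, hy2, o2⟩ := E2
    obtain ⟨x3, hx3, y3, hy3, o3⟩ := E3
    intro i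
    fin_cases i
    exacts [fun e => o1 (e hx1 hy1), fun e => o2 (e hx2 hy2), fun e => o3 (e hx3 hy3)]
  rotate_left 1
  · obtain ⟨x1, hx1, y1, hy1, o1⟩ := E1
    obtain ⟨x2, hx2, y2, hy2, o2⟩ := E2
    obtain ⟨x3, hx3, y3, hy3, o3⟩ := E3
    intro i
    fin_cases i
    exacts [fun e => o3 (e hy3 hx3).symm, fun e => o1 (e hy1 hx1).symm,
      fun e => o2 (e hy2 hx2).symm]
  all_goals
    clear E1 E2 E3
    simp [Fin.forall_fin_succ, SimpleGraph.IsClique, Set.Pairwise, IsCompleteTo,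
      IsAnticompleteTo]
    grind

set_option maxHeartbeats 4000000 in
theorem wk_of_pec (h : IsPeculiar G) :
    ∃ C1 C2 C3 Q1 Q2 Q3, Wk G C1 C2 C3 Q1 Q2 Q3 := by
  have sym : ∀ a b, G.Adj a b → G.Adj b a := fun a b h => h.symm
  obtain ⟨A, B, Q, -, dj, -, -, nQ, cA, cB, cQ, Ac, An, Bc, Bn, Qc, Qa⟩ := h
  have dis : ∀ i j k l : Fin 3, (i, j) ≠ (k, l) → ∀ x, x ∈ ![A, B, Q] i j →
      x ∉ ![A, B, Q] k l := fun i j k l hne x hx =>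
    Set.disjoint_left.1 (dj hne) hx
  simp [Fin.forall_fin_succ, Set.Nonempty, SimpleGraph.IsClique, Set.Pairwise, IsCompleteTo,
      IsAnticompleteTo] at nQ cA cB cQ Ac An Bc Bn Qc Qa dis
  clear dj
  refine ⟨A 0 ∪ B 0, A 1 ∪ B 1, A 2 ∪ B 2, Q 0, Q 1, Q 2, ?_⟩
  have E12 : ∃ x ∈ A 0 ∪ B 0, ∃ y ∈ A 1 ∪ B 1, ¬ G.Adj x y := by
    obtain ⟨⟨x, hx, y, hy, n⟩, -, -⟩ := An
    exact ⟨x, Or.inl hx, y, Or.inr hy, n⟩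
  have E23 : ∃ x ∈ A 1 ∪ B 1, ∃ y ∈ A 2 ∪ B 2, ¬ G.Adj x y := by
    obtain ⟨-, ⟨x, hx, y, hy, n⟩, -⟩ := An
    exact ⟨x, Or.inl hx, y, Or.inr hy, n⟩
  have E13 : ∃ x ∈ A 0 ∪ B 0, ∃ y ∈ A 2 ∪ B 2, ¬ G.Adj x y := by
    obtain ⟨-, -, ⟨x, hx, y, hy, n⟩⟩ := An
    exact ⟨y, Or.inr hy, x, Or.inl hx, fun e => n e.symm⟩
  obtain ⟨N1, N2, N3⟩ := nQ
  clear An Bn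
  constructor <;> first
    | assumption
    | (clear E12 E23 E13 N1 N2 N3; (try simp only [Set.mem_union]); grind)

theorem wk_of_peculiar {s : Set V} (h : IsPeculiar (G.induce s)) :
    ∃ C1 C2 C3 Q1 Q2 Q3, Wk G C1 C2 C3 Q1 Q2 Q3 := by
  obtain ⟨C1, C2, C3, Q1, Q2, Q3, h⟩ := wk_of_pec h
  have cl : ∀ C : Set s, (∀ x ∈ C, ∀ y ∈ C, x ≠ y → (G.induce s).Adj x y) →
      ∀ x ∈ Subtype.val '' C, ∀ y ∈ Subtype.val '' C, x ≠ y → G.Adj x y := by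
    rintro C hC _ ⟨x, hx, rfl⟩ _ ⟨y, hy, rfl⟩ hne
    exact hC x hx y hy (fun e => hne (congrArg _ e))
  have ne : ∀ C : Set s, (∃ x, x ∈ C) → ∃ x, x ∈ Subtype.val '' C := by
    rintro C ⟨x, hx⟩
    exact ⟨x, x, hx, rfl⟩
  have co : ∀ C D : Set s, (∀ x ∈ C, ∀ y ∈ D, (G.induce s).Adj x y) →
      ∀ x ∈ Subtype.val '' C, ∀ y ∈ Subtype.val '' D, G.Adj x y := by
    rintro C D hC _ ⟨x, hx, rfl⟩ _ ⟨y, hy, rfl⟩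
    exact hC x hx y hy
  have an : ∀ C D : Set s, (∀ x ∈ C, ∀ y ∈ D, ¬ (G.induce s).Adj x y) →
      ∀ x ∈ Subtype.val '' C, ∀ y ∈ Subtype.val '' D, ¬ G.Adj x y := by
    rintro C D hC _ ⟨x, hx, rfl⟩ _ ⟨y, hy, rfl⟩
    exact hC x hx y hy
  have si : ∀ C D E : Set s, (∀ x ∈ C, ∀ y ∈ D, ∀ z ∈ E,
      (G.induce s).Adj x y ∨ (G.induce s).Adj x z) →
      ∀ x ∈ Subtype.val '' C, ∀ y ∈ Subtype.val '' D, ∀ z ∈ Subtype.val '' E,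
      G.Adj x y ∨ G.Adj x z := by
    rintro C D E hC _ ⟨x, hx, rfl⟩ _ ⟨y, hy, rfl⟩ _ ⟨z, hz, rfl⟩
    exact hC x hx y hy z hz
  have ex : ∀ C D : Set s, (∃ x ∈ C, ∃ y ∈ D, ¬ (G.induce s).Adj x y) →
      ∃ x ∈ Subtype.val '' C, ∃ y ∈ Subtype.val '' D, ¬ G.Adj x y := by
    rintro C D ⟨x, hx, y, hy, n⟩
    exact ⟨x, ⟨x, hx, rfl⟩, y, ⟨y, hy, rfl⟩, n⟩
  have dj : ∀ C D : Set s, (∀ x ∈ C, x ∉ D) →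
      ∀ x ∈ Subtype.val '' C, x ∉ Subtype.val '' D := by
    rintro C D hC _ ⟨x, hx, rfl⟩ ⟨y, hy, e⟩
    exact hC x hx (Subtype.ext e ▸ hy)
  exact ⟨_, _, _, _, _, _, cl _ h.c1, cl _ h.c2, cl _ h.c3, cl _ h.k1, cl _ h.k2, cl _ h.k3,
    ne _ h.n1, ne _ h.n2, ne _ h.n3, co _ _ h.q12, co _ _ h.q13, co _ _ h.q21, co _ _ h.q23,
    co _ _ h.q31, co _ _ h.q32, an _ _ h.a1, an _ _ h.a2, an _ _ h.a3, an _ _ h.a12,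
    an _ _ h.a13, an _ _ h.a23, si _ _ _ h.s1, si _ _ _ h.s2, si _ _ _ h.s3, ex _ _ h.e12,
    ex _ _ h.e13, ex _ _ h.e23, dj _ _ h.d12, dj _ _ h.d13, dj _ _ h.d23, dj _ _ h.g1,
    dj _ _ h.g2, dj _ _ h.g3, dj _ _ h.f12, dj _ _ h.f13, dj _ _ h.f23⟩

end Wk

/-- A connected claw-free graph with no induced `C₅` that contains a
peculiar induced subgraph is itself peculiar. -/
theorem peculiar_of_contains_peculiar
    {V : Type*} [Fintype V] (G : SimpleGraph V)
    (hconn : G.Connected) (hclaw : IsClawFree G) (hC5 : ¬ HasInducedC5 G)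
    (hsub : ∃ s : Set V, IsPeculiar (G.induce s)) :
    IsPeculiar G := by
  obtain ⟨s, hs⟩ := hsub
  let F : Set (Set V) := {S | ∃ C1 C2 C3 Q1 Q2 Q3, Wk G C1 C2 C3 Q1 Q2 Q3 ∧
    un C1 C2 C3 Q1 Q2 Q3 = S}
  obtain ⟨C1, C2, C3, Q1, Q2, Q3, h0⟩ := wk_of_peculiar hs
  have hne : F.Nonempty := ⟨_, _, _, _, _, _, _, h0, rfl⟩
  obtain ⟨S, hS⟩ := (Set.toFinite F).exists_maximal hne
  obtain ⟨⟨D1, D2, D3, P1, P2, P3, h, rfl⟩, hmax⟩ := hS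
  refine h.peculiar ?_
  by_contra hne
  obtain ⟨w, hw⟩ := (Set.ne_univ_iff_exists_notMem _).1 hne
  obtain ⟨p, hp⟩ := h.n1
  obtain ⟨W⟩ := hconn.preconnected p w
  obtain ⟨d, -, hd1, hd2⟩ := W.exists_boundary_dart (un D1 D2 D3 P1 P2 P3)
    (mem_un.2 (by tauto)) hw
  obtain ⟨E1, E2, E3, R1, R2, R3, hE, hEu⟩ := h.extend hclaw hC5 hd2 ⟨_, hd1, d.adj.symm⟩
  have := hmax (y := insert d.snd (un D1 D2 D3 P1 P2 P3)) ⟨_, _, _, _, _, _, hE, hEu⟩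
    (Set.subset_insert _ _)
  exact hd2 (this (Set.mem_insert _ _))
end

section
/- Let G be a peculiar graph with clique number ω(G) = 4, with peculiar partition (A_1, B_1, A_2, B_2, A_3, B_3, Q_1, Q_2, Q_3). Then all nine sets A_i, B_i, Q_i (i = 1, 2, 3) have size exactly 1; in particular G has exactly nine vertices. -/
open SimpleGraph

variable {V : Type*}

theorem aux_clique_union {W : Type*} (G : SimpleGraph W) {S T : Set W} (hS : G.IsClique S)
    (hT : G.IsClique T) (h : IsCompleteTo G S T) : G.IsClique (S ∪ T) := by
  rintro x (hx | hx) y (hy | hy) hne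
  · exact hS hx hy hne
  · exact h hx hy
  · exact (h hy hx).symm
  · exact hT hx hy hne

theorem aux_ncard_union {W : Type*} [Fintype W] (G : SimpleGraph W) {S T : Set W}
    (h : IsCompleteTo G S T) : (S ∪ T).ncard = S.ncard + T.ncard := by
  apply Set.ncard_union_eq _ (Set.toFinite _) (Set.toFinite _)
  rw [Set.disjoint_left]
  intro x hx hy
  exact G.irrefl (h hx hy)

theorem aux_clique_le {W : Type*} [Fintype W] (G : SimpleGraph W) {S : Set W}
    (hS : G.IsClique S) : S.ncard ≤ cliqueNumber G := by
  classical
  unfold cliqueNumber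
  apply le_csSup
  · refine ⟨Fintype.card W, ?_⟩
    rintro n ⟨s, hs⟩
    rw [← hs.card_eq]
    exact Finset.card_le_univ s
  · refine ⟨S.toFinset, ?_, ?_⟩
    · simpa using hS
    · rw [Set.ncard_eq_toFinset_card']

/-- In a peculiar graph with clique number 4, all nine sets of the
peculiar partition are singletons; in particular the graph has exactly nine vertices. -/
theorem peculiar_omega_four_singletons
    {V : Type*} [Fintype V] (G : SimpleGraph V) (A B Q : Fin 3 → Set V)
    (hpart : IsPeculiarPartition G A B Q) (homega : cliqueNumber G = 4) :
    (∀ i, (A i).ncard = 1) ∧ (∀ i, (B i).ncard = 1) ∧ (∀ i, (Q i).ncard = 1) ∧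
      Fintype.card V = 9 := by
  classical
  have key : ∀ i, (Q i).ncard + ((B (i+1)).ncard + ((A (i+1)).ncard + (A (i+2)).ncard)) ≤ 4 := by
    intro i
    have e1 : i + 1 + 1 = i + 2 := by omega
    have c1 : IsCompleteTo G (A (i+1)) (A (i+2)) := fun s hs t ht =>
      hpart.A_complete (i+1) hs (by rw [e1]; simp [ht])
    have c2 : IsCompleteTo G (B (i+1)) (A (i+1) ∪ A (i+2)) := fun s hs t ht =>
      hpart.B_complete (i+1) hs (by
        rw [e1]; rcases ht with ht | ht <;> simp [ht])
    have c3 : IsCompleteTo G (Q i) (B (i+1) ∪ (A (i+1) ∪ A (i+2))) := fun s hs t ht =>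
      hpart.Q_complete i hs (by
        rcases ht with ht | ht | ht <;> simp [ht])
    rw [← aux_ncard_union G c1, ← aux_ncard_union G c2, ← aux_ncard_union G c3, ← homega]
    exact aux_clique_le G (aux_clique_union G (hpart.cliqueQ i)
      (aux_clique_union G (hpart.cliqueB _)
        (aux_clique_union G (hpart.cliqueA _) (hpart.cliqueA _) c1) c2) c3)
  have pA : ∀ i, 0 < (A i).ncard := fun i => (Set.ncard_pos (Set.toFinite _)).2 (hpart.nonemptyA i)
  have pB : ∀ i, 0 < (B i).ncard := fun i => (Set.ncard_pos (Set.toFinite _)).2 (hpart.nonemptyB i)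
  have pQ : ∀ i, 0 < (Q i).ncard := fun i => (Set.ncard_pos (Set.toFinite _)).2 (hpart.nonemptyQ i)
  have e2 : ∀ i : Fin 3, i + 2 + 1 = i := by decide
  have hA : ∀ i, (A i).ncard = 1 := by
    intro i
    have := key (i+2)
    rw [e2] at this
    have := pA i; have := pB i; have := pQ (i+2); have := pA (i+2+2)
    omega
  have hB : ∀ i, (B i).ncard = 1 := by
    intro i
    have := key (i+2)
    rw [e2] at this
    have := pA i; have := pB i; have := pQ (i+2); have := pA (i+2+2)
    omega
  have hQ : ∀ i, (Q i).ncard = 1 := by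
    intro i
    have := key i
    have := pQ i; have := pB (i+1); have := pA (i+1); have := pA (i+2)
    omega
  refine ⟨hA, hB, hQ, ?_⟩
  have hall : ∀ p : Fin 3 × Fin 3, ∃ v, ![A, B, Q] p.1 p.2 = {v} := by
    rintro ⟨j, i⟩
    fin_cases j
    · exact Set.ncard_eq_one.1 (hA i)
    · exact Set.ncard_eq_one.1 (hB i)
    · exact Set.ncard_eq_one.1 (hQ i)
  choose f hf using hall
  have hbij : Function.Bijective f := by
    constructor
    · intro p q hpq
      by_contra hne
      have hd := hpart.pairwiseDisjoint hne
      simp only [Function.onFun] at hd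
      rw [hf p, hf q, hpq] at hd
      simp at hd
    · intro v
      have hm : ∃ p : Fin 3 × Fin 3, v ∈ ![A, B, Q] p.1 p.2 := by
        rcases hpart.cover v with ⟨i, h⟩ | ⟨i, h⟩ | ⟨i, h⟩
        · exact ⟨(0, i), h⟩
        · exact ⟨(1, i), h⟩
        · exact ⟨(2, i), h⟩
      obtain ⟨p, hp⟩ := hm
      rw [hf p] at hp
      exact ⟨p, hp.symm⟩
  have := Fintype.card_of_bijective hbij
  simpa using this.symm
end

section
/- Let G be a peculiar graph with clique number ω(G) = 4. Then G is 4-choosable. -/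
open SimpleGraph

variable {V : Type*}

namespace PecProof

/-- decrement entry `i` -/
def dec : List ℕ → ℕ → List ℕ
  | [], _ => []
  | a :: l, 0 => (a - 1) :: l
  | a :: l, i + 1 => a :: dec l i

/-- entry `i` -/
def ent : List ℕ → ℕ → ℕ
  | [], _ => 0
  | a :: _, 0 => a
  | _ :: l, i + 1 => ent l i

lemma ent_dec (l : List ℕ) (i j : ℕ) : ent (dec l i) j = ent l j - if i = j then 1 else 0 := by
  induction l generalizing i j with
  | nil => simp [dec, ent]
  | cons a l ih => cases i <;> cases j <;> simp [dec, ent, ih]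

noncomputable def decode (l : List ℕ) : Fin 9 →₀ ℕ :=
  Finsupp.equivFunOnFinite.symm (fun i => ent l i.val)

lemma decode_apply (l : List ℕ) (i : Fin 9) : decode l i = ent l i.val := rfl

lemma decode_dec (l : List ℕ) (i : Fin 9) :
    decode (dec l i.val) = decode l - Finsupp.single i 1 := by
  ext j
  simp [decode_apply, ent_dec, Finsupp.single_apply, Fin.ext_iff]

/-- coefficient computation -/
def co : List (Fin 9 × Fin 9) → List ℕ → ℤ
  | [], l => if ∀ i : Fin 9, ent l i.val = 0 then 1 else 0
  | e :: es, l =>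
    (match ent l e.1.val with
      | 0 => 0
      | _ + 1 => co es (dec l e.1.val)) -
    (match ent l e.2.val with
      | 0 => 0
      | _ + 1 => co es (dec l e.2.val))

open MvPolynomial in
noncomputable def gp (es : List (Fin 9 × Fin 9)) : MvPolynomial (Fin 9) ℤ :=
  (es.map (fun e => X e.1 - X e.2)).prod

lemma coeff_gp (es : List (Fin 9 × Fin 9)) (l : List ℕ) :
    (gp es).coeff (decode l) = co es l := by
  induction es generalizing l with
  | nil =>
    simp only [gp, List.map_nil, List.prod_nil, co, MvPolynomial.coeff_one]
    congr 1
    rw [Finsupp.ext_iff]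
    simp [decode_apply, eq_comm]
  | cons e es ih =>
    have h : ∀ i : Fin 9, (MvPolynomial.X i * gp es).coeff (decode l) =
        (match ent l i.val with
          | 0 => 0
          | _ + 1 => co es (dec l i.val)) := by
      intro i
      rw [MvPolynomial.coeff_X_mul', ← decode_dec, ih]
      simp only [Finsupp.mem_support_iff, decode_apply]
      cases ent l i.val <;> simp
    have h2 : gp (e :: es) = MvPolynomial.X e.1 * gp es - MvPolynomial.X e.2 * gp es := by
      simp [gp, sub_mul]
    rw [h2, MvPolynomial.coeff_sub, h, h, co]

lemma gp_hom (es : List (Fin 9 × Fin 9)) : (gp es).IsHomogeneous es.length := by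
  induction es with
  | nil => simpa [gp] using MvPolynomial.isHomogeneous_one (Fin 9) ℤ
  | cons e es ih =>
    have h2 : gp (e :: es) = (MvPolynomial.X e.1 - MvPolynomial.X e.2) * gp es := by
      simp [gp]
    rw [h2, List.length_cons, add_comm]
    exact ((MvPolynomial.isHomogeneous_X _ _).sub (MvPolynomial.isHomogeneous_X _ _)).mul ih

def edges : List (Fin 9 × Fin 9) :=
  [(6, 0), (8, 0), (0, 1), (0, 2), (0, 4), (0, 5), (8, 2), (8, 5), (8, 4), (7, 4), (2, 4), (3, 4),
   (4, 5), (6, 3), (6, 5), (6, 1), (1, 5), (3, 5), (7, 1), (1, 2), (1, 3), (7, 2), (2, 3), (7, 3)]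

def expo : List ℕ := [0, 3, 3, 3, 3, 3, 3, 3, 3]

set_option maxRecDepth 100000 in
lemma co_edges : co edges expo = 2 := by
  decide +kernel

lemma color9 (L : Fin 9 → Finset ℕ) (hL : ∀ i, (L i).card = 4) :
    ∃ c : Fin 9 → ℕ, (∀ i, c i ∈ L i) ∧ ∀ e ∈ edges, c e.1 ≠ c e.2 := by
  have hc : (gp edges).coeff (decode expo) ≠ 0 := by
    rw [coeff_gp, co_edges]; norm_num
  have h0 : gp edges ≠ 0 := by
    intro h; rw [h] at hc; simp at hc
  have hd : (gp edges).totalDegree = (decode expo).degree := by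
    rw [(gp_hom edges).totalDegree h0, Finsupp.degree_eq_sum]
    simp only [decode_apply]
    decide
  obtain ⟨s, hs, hev⟩ := MvPolynomial.combinatorial_nullstellensatz_exists_eval_nonzero
    (gp edges) (decode expo) hc hd (fun i => (L i).image (fun n : ℕ => (n : ℤ))) (by
      intro i
      rw [Finset.card_image_of_injective _ Nat.cast_injective, hL, decode_apply]
      revert i; decide)
  have hs' : ∀ i, ∃ n ∈ L i, (n : ℤ) = s i := fun i => by simpa using hs i
  choose c hcL hcs using hs'
  refine ⟨c, hcL, fun e he hce => hev ?_⟩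
  have h1 : s e.1 = s e.2 := by rw [← hcs, ← hcs, hce]
  rw [gp, map_list_prod, List.prod_eq_zero_iff, List.map_map, List.mem_map]
  exact ⟨e, he, by simp [h1]⟩

lemma five {V : Type*} [Fintype V] {G : SimpleGraph V} (homega : cliqueNumber G = 4)
    {a b c d e : V} (h1 : G.Adj a b) (h2 : G.Adj a c) (h3 : G.Adj a d) (h4 : G.Adj a e)
    (h5 : G.Adj b c) (h6 : G.Adj b d) (h7 : G.Adj b e) (h8 : G.Adj c d) (h9 : G.Adj c e)
    (h10 : G.Adj d e) : False := by
  classical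
  have hcl : G.IsNClique 5 {a, b, c, d, e} := by
    constructor
    · simp [SimpleGraph.isClique_insert, *]
    · have := h1.ne; have := h2.ne; have := h3.ne; have := h4.ne; have := h5.ne
      have := h6.ne; have := h7.ne; have := h8.ne; have := h9.ne; have := h10.ne
      simp [*]
  have hb : BddAbove {n | ∃ s : Finset V, G.IsNClique n s} := by
    refine ⟨Fintype.card V, ?_⟩
    rintro n ⟨s, hs⟩
    rw [← hs.card_eq]
    exact s.card_le_univ
  have := le_csSup hb ⟨_, hcl⟩
  unfold cliqueNumber at homega
  omega

lemma cover9 (P : Fin 9 → Fin 9 → Prop) (hd : ∀ i, P i i)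
    (h : ∀ i j, (i, j) ∉ edges → (j, i) ∉ edges → i < j → P i j) (hs : ∀ i j, P i j → P j i) :
    ∀ i j, (i, j) ∉ edges → (j, i) ∉ edges → P i j := by
  intro i j h1 h2
  rcases lt_trichotomy i j with hij | hij | hij
  · exact h i j h1 h2 hij
  · exact hij ▸ hd i
  · exact hs _ _ (h j i h2 h1 hij)

end PecProof

/-- Every peculiar graph with clique number 4 is 4-choosable. -/
theorem peculiar_omega_four_choosable
    {V : Type*} [Fintype V] (G : SimpleGraph V)
    (hpec : IsPeculiar G) (homega : cliqueNumber G = 4) :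
    Choosable G 4 := by
  obtain ⟨A, B, Q, h⟩ := hpec
  choose a ha using h.nonemptyA
  choose b hb using h.nonemptyB
  choose q hq using h.nonemptyQ
  have aa : ∀ i, ∀ x ∈ A i, ∀ y ∈ A (i + 1), G.Adj x y := fun i x hx y hy =>
    h.A_complete i hx (by simp [hy])
  have ab : ∀ i, ∀ x ∈ A i, ∀ y ∈ B i, G.Adj x y := fun i x hx y hy =>
    h.A_complete i hx (by simp [hy])
  have ba : ∀ i, ∀ x ∈ B i, ∀ y ∈ A (i + 1), G.Adj x y := fun i x hx y hy =>
    h.B_complete i hx (by simp [hy])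
  have e1 : ∀ i : Fin 3, i + 2 + 1 = i := by decide
  have e2 : ∀ i : Fin 3, i + 2 + 2 = i + 1 := by decide
  have qa : ∀ i, ∀ x ∈ Q (i + 2), ∀ y ∈ A i, G.Adj x y := fun i x hx y hy =>
    h.Q_complete (i + 2) hx (by simp [hy, e1, e2])
  have qa' : ∀ i, ∀ x ∈ Q (i + 2), ∀ y ∈ A (i + 1), G.Adj x y := fun i x hx y hy =>
    h.Q_complete (i + 2) hx (by simp [hy, e1, e2])
  have qb : ∀ i, ∀ x ∈ Q (i + 2), ∀ y ∈ B i, G.Adj x y := fun i x hx y hy =>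
    h.Q_complete (i + 2) hx (by simp [hy, e1, e2])
  have uA : ∀ i, ∀ x ∈ A i, x = a i := by
    intro i x hx
    by_contra hne
    exact PecProof.five homega (h.cliqueA i hx (ha i) hne)
      (aa i _ hx _ (ha _)) (ab i _ hx _ (hb _)) (qa i _ (hq _) _ hx).symm
      (aa i _ (ha i) _ (ha _)) (ab i _ (ha i) _ (hb _)) (qa i _ (hq _) _ (ha i)).symm
      (ba i _ (hb _) _ (ha _)).symm (qa' i _ (hq _) _ (ha _)).symm (qb i _ (hq _) _ (hb _)).symm
  have uB : ∀ i, ∀ x ∈ B i, x = b i := by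
    intro i x hx
    by_contra hne
    exact PecProof.five homega (h.cliqueB i hx (hb i) hne)
      (ba i _ hx _ (ha _)) (ab i _ (ha _) _ hx).symm (qb i _ (hq _) _ hx).symm
      (ba i _ (hb i) _ (ha _)) (ab i _ (ha i) _ (hb _)).symm (qb i _ (hq _) _ (hb i)).symm
      (aa i _ (ha _) _ (ha _)).symm (qa' i _ (hq _) _ (ha _)).symm (qa i _ (hq _) _ (ha _)).symm
  have uQ' : ∀ i, ∀ x ∈ Q (i + 2), x = q (i + 2) := by
    intro i x hx
    by_contra hne
    exact PecProof.five homega (h.cliqueQ _ hx (hq _) hne)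
      (qa' i _ hx _ (ha _)) (qa i _ hx _ (ha _)) (qb i _ hx _ (hb _))
      (qa' i _ (hq _) _ (ha _)) (qa i _ (hq _) _ (ha _)) (qb i _ (hq _) _ (hb _))
      (aa i _ (ha _) _ (ha _)).symm (ba i _ (hb _) _ (ha _)).symm (ab i _ (ha _) _ (hb _))
  have uQ : ∀ i, ∀ x ∈ Q i, x = q i := by
    intro i x hx
    have e3 : i + 1 + 2 = i := (by decide : ∀ i : Fin 3, i + 1 + 2 = i) i
    have := uQ' (i + 1) x
    rw [e3] at this
    exact this hx
  have nab : ∀ i, ¬ G.Adj (a i) (b (i + 1)) := by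
    intro i hadj
    apply h.A_not_complete i
    intro s hs t ht
    rw [uA i s hs, uB _ t ht]; exact hadj
  have nqa : ∀ i, ¬ G.Adj (q i) (a i) := fun i =>
    h.Q_anticomplete i (hq i) (by simp [ha])
  have nqb : ∀ i, ¬ G.Adj (q i) (b i) := fun i =>
    h.Q_anticomplete i (hq i) (by simp [hb])
  have nqq : ∀ i, ¬ G.Adj (q i) (q (i + 1)) := fun i =>
    h.Q_anticomplete i (hq i) (by simp [hq])
  let f : Fin 9 → V := ![a 0, a 1, a 2, b 1, b 2, b 0, q 2, q 0, q 1]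
  have hsurj : ∀ v, ∃ i, f i = v := by
    intro v
    rcases h.cover v with ⟨i, hi⟩ | ⟨i, hi⟩ | ⟨i, hi⟩
    · rw [uA i v hi]
      fin_cases i
      exacts [⟨0, rfl⟩, ⟨1, rfl⟩, ⟨2, rfl⟩]
    · rw [uB i v hi]
      fin_cases i
      exacts [⟨5, rfl⟩, ⟨3, rfl⟩, ⟨4, rfl⟩]
    · rw [uQ i v hi]
      fin_cases i
      exacts [⟨7, rfl⟩, ⟨8, rfl⟩, ⟨6, rfl⟩]
  have hnon : ∀ i j, (i, j) ∉ PecProof.edges → (j, i) ∉ PecProof.edges → ¬ G.Adj (f i) (f j) := by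
    refine PecProof.cover9 (fun i j => ¬ G.Adj (f i) (f j)) (fun i => G.irrefl)
      ?_ (fun i j hij hji => hij hji.symm)
    intro i j h1 h2 hij
    have key : (i, j) ∈ ([(0, 3), (1, 4), (2, 5), (0, 7), (1, 8), (2, 6), (3, 8), (4, 6), (5, 7),
        (6, 7), (7, 8), (6, 8)] : List (Fin 9 × Fin 9)) := by
      clear * - h1 h2 hij
      revert i j; decide
    simp only [List.mem_cons, Prod.mk.injEq, List.not_mem_nil, or_false] at key
    rcases key with k | k | k | k | k | k | k | k | k | k | k | k <;> obtain ⟨rfl, rfl⟩ := k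
    · exact nab 0
    · exact nab 1
    · exact nab 2
    · exact fun k => nqa 0 k.symm
    · exact fun k => nqa 1 k.symm
    · exact fun k => nqa 2 k.symm
    · exact fun k => nqb 1 k.symm
    · exact fun k => nqb 2 k.symm
    · exact fun k => nqb 0 k.symm
    · exact nqq 2
    · exact nqq 0
    · exact fun k => nqq 1 k.symm
  intro L hL
  obtain ⟨c, hc, hce⟩ := PecProof.color9 (fun i => L (f i)) (fun i => hL _)
  choose g hg using hsurj
  refine ⟨fun v => c (g v), fun v => ?_, fun u w huw heq => ?_⟩
  · have := hc (g v)
    simpa only [hg] using this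
  · by_cases h1 : (g u, g w) ∈ PecProof.edges
    · exact hce _ h1 heq
    · by_cases h2 : (g w, g u) ∈ PecProof.edges
      · exact hce _ h2 heq.symm
      · apply hnon _ _ h1 h2
        rw [hg, hg]; exact huw
end

section
/- Let H be a cobipartite graph whose vertex set is partitioned into two cliques X and Y with |X| ≤ |Y|. Assume that there are exactly |X| non-adjacent pairs {x, y} with x ∈ X and y ∈ Y, and that these pairs form a matching in the complement of H. Let L be a list assignment on V(H) such that |L(x)| ≥ |X| for all x ∈ X and |L(y)| ≥ |Y| for all y ∈ Y. Then H admits an L-coloring. -/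
open SimpleGraph

variable {V : Type*}

open Classical in
theorem cml_aux {V : Type*} (f : V → V) (n : ℕ) : ∀ (X Y : Finset V) (L : V → Finset ℕ),
    X.card = n → Disjoint X Y → X.card ≤ Y.card → (∀ x ∈ X, f x ∈ Y) →
    (∀ x ∈ X, ∀ x' ∈ X, f x = f x' → x = x') →
    (∀ x ∈ X, X.card ≤ (L x).card) → (∀ y ∈ Y, Y.card ≤ (L y).card) →
    ∃ c : V → ℕ, (∀ v ∈ X ∪ Y, c v ∈ L v) ∧
      ∀ u ∈ X ∪ Y, ∀ w ∈ X ∪ Y, c u = c w → u = w ∨ (u ∈ X ∧ w = f u) ∨ (w ∈ X ∧ u = f w) := by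
  induction n using Nat.strong_induction_on with
  | _ n ih
  intro X Y L hn hd hle hf hinj hLX hLY
  by_cases hcom : ∃ x ∈ X, ∃ a, a ∈ L x ∧ a ∈ L (f x)
  case pos =>
    obtain ⟨x, hx, a, ha, ha'⟩ := hcom
    have hfx := hf x hx
    have hpos := Finset.card_pos.2 ⟨x, hx⟩
    have hcX := Finset.card_erase_of_mem hx
    have hcY := Finset.card_erase_of_mem hfx
    obtain ⟨c, hc1, hc2⟩ := ih (n - 1) (by omega) (X.erase x) (Y.erase (f x)) (fun v => (L v).erase a)
      (by omega)
      (hd.mono (Finset.erase_subset _ _) (Finset.erase_subset _ _))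
      (by omega)
      (by
        intro z hz
        rw [Finset.mem_erase] at hz ⊢
        exact ⟨fun h => hz.1 (hinj _ hz.2 _ hx h), hf z hz.2⟩)
      (by
        intro z hz z' hz'
        exact hinj z (Finset.mem_of_mem_erase hz) z' (Finset.mem_of_mem_erase hz'))
      (by
        intro z hz
        have h1 := hLX z (Finset.mem_of_mem_erase hz)
        have h2 := Finset.pred_card_le_card_erase (s := L z) (a := a)
        omega)
      (by
        intro z hz
        have h1 := hLY z (Finset.mem_of_mem_erase hz)
        have h2 := Finset.pred_card_le_card_erase (s := L z) (a := a)
        omega)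
    have key : ∀ v ∈ X ∪ Y, v ≠ x → v ≠ f x → v ∈ X.erase x ∪ Y.erase (f x) := by
      intro v hv h1 h2
      simp only [Finset.mem_union, Finset.mem_erase] at hv ⊢
      tauto
    have hca : ∀ v ∈ X ∪ Y, v ≠ x → v ≠ f x → c v ≠ a ∧ c v ∈ L v := by
      intro v hv h1 h2
      exact Finset.mem_erase.1 (hc1 v (key v hv h1 h2))
    refine ⟨fun v => if v = x ∨ v = f x then a else c v, ?_, ?_⟩
    · intro v hv
      by_cases h : v = x ∨ v = f x
      · simp only [h, if_true]
        rcases h with rfl | rfl <;> assumption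
      · simp only [h, if_false]
        push Not at h
        exact (hca v hv h.1 h.2).2
    · intro u hu w hw huw
      by_cases h : u = x ∨ u = f x <;> by_cases h' : w = x ∨ w = f x
      · rcases h with rfl | rfl <;> rcases h' with rfl | rfl <;> simp [hx]
      · simp only [h, h', if_true, if_false] at huw
        push Not at h'
        exact absurd huw.symm (hca w hw h'.1 h'.2).1
      · simp only [h, h', if_true, if_false] at huw
        push Not at h
        exact absurd huw (hca u hu h.1 h.2).1
      · simp only [h, h', if_false] at huw
        push Not at h h'
        rcases hc2 u (key u hu h.1 h.2) w (key w hw h'.1 h'.2) huw with h | h | h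
        · exact Or.inl h
        · exact Or.inr (Or.inl ⟨Finset.mem_of_mem_erase h.1, h.2⟩)
        · exact Or.inr (Or.inr ⟨Finset.mem_of_mem_erase h.1, h.2⟩)
  case neg =>
    have hall : ∀ s : Finset {v // v ∈ X ∪ Y}, s.card ≤ (s.biUnion fun v => L v.1).card := by
      intro s
      have hsub : ∀ v ∈ s, L v.1 ⊆ s.biUnion fun v => L v.1 :=
        fun v hv => Finset.subset_biUnion_of_mem (fun v : {v // v ∈ X ∪ Y} => L v.1) hv
      have hsc : s.card = (s.map (Function.Embedding.subtype _)).card := (Finset.card_map _).symm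
      set T := s.map (Function.Embedding.subtype _) with hT
      have hTsub : T ⊆ X ∪ Y := by
        intro v hv
        rw [hT, Finset.mem_map] at hv
        obtain ⟨w, _, rfl⟩ := hv
        exact w.2
      have hsub' : ∀ v ∈ T, L v ⊆ s.biUnion fun v => L v.1 := by
        intro v hv
        rw [hT, Finset.mem_map] at hv
        obtain ⟨w, hw, rfl⟩ := hv
        exact hsub w hw
      rw [hsc]
      by_cases hp : ∃ x ∈ X, x ∈ T ∧ f x ∈ T
      · obtain ⟨x, hx, h1, h2⟩ := hp
        have hdl : Disjoint (L x) (L (f x)) := by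
          rw [Finset.disjoint_left]
          intro a h3 h4
          exact hcom ⟨x, hx, a, h3, h4⟩
        have h5 := Finset.card_le_card (Finset.union_subset (hsub' _ h1) (hsub' _ h2))
        rw [Finset.card_union_of_disjoint hdl] at h5
        have h6 := Finset.card_le_card hTsub
        rw [Finset.card_union_of_disjoint hd] at h6
        have h7 := hLX x hx
        have h8 := hLY _ (hf x hx)
        omega
      · by_cases hy : ∃ y ∈ Y, y ∈ T
        · obtain ⟨y, hy, hyT⟩ := hy
          have h1 : T.card ≤ Y.card := by
            apply Finset.card_le_card_of_injOn (fun v => if v ∈ X then f v else v)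
            · intro v hv
              have := hTsub hv
              rw [Finset.mem_union] at this
              by_cases h : v ∈ X
              · simpa [h] using hf v h
              · simpa [h] using this
            · intro v hv w hw hvw
              rw [Finset.mem_coe] at hv hw
              simp only at hvw
              split_ifs at hvw with h h' h'
              · exact hinj v h w h' hvw
              · exact absurd ⟨v, h, hv, hvw ▸ hw⟩ hp
              · exact absurd ⟨w, h', hw, hvw ▸ hv⟩ hp
              · exact hvw
          exact (h1.trans (hLY y hy)).trans (Finset.card_le_card (hsub' y hyT))
        · have hTX : T ⊆ X := by
            intro v hv
            rcases Finset.mem_union.1 (hTsub hv) with h | h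
            · exact h
            · exact absurd ⟨v, h, hv⟩ hy
          rcases T.eq_empty_or_nonempty with h | ⟨v, hv⟩
          · simp [h]
          · exact ((Finset.card_le_card hTX).trans (hLX v (hTX hv))).trans
              (Finset.card_le_card (hsub' v hv))
    obtain ⟨g, hg, hgm⟩ := (Finset.all_card_le_biUnion_card_iff_exists_injective _).1 hall
    refine ⟨fun v => if h : v ∈ X ∪ Y then g ⟨v, h⟩ else 0, ?_, ?_⟩
    · intro v hv
      simp only [hv, dif_pos]
      exact hgm ⟨v, hv⟩
    · intro u hu w hw huw
      simp only [hu, hw, dif_pos] at huw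
      exact Or.inl (Subtype.ext_iff.1 (hg huw))

/-- A cobipartite graph partitioned into cliques `X`, `Y` with
`|X| ≤ |Y|`, whose `|X|` non-edges between `X` and `Y` form a matching in the
complement, is `L`-colorable whenever `|L(x)| ≥ |X|` on `X` and `|L(y)| ≥ |Y|` on `Y`. -/
theorem cobipartite_matching_list_colorable
    {V : Type*} [Fintype V] (H : SimpleGraph V) (X Y : Set V)
    (hdisj : Disjoint X Y) (hcover : X ∪ Y = Set.univ)
    (hX : H.IsClique X) (hY : H.IsClique Y) (hle : X.ncard ≤ Y.ncard)
    (hcount : {p : V × V | p.1 ∈ X ∧ p.2 ∈ Y ∧ ¬H.Adj p.1 p.2}.ncard = X.ncard)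
    (hm1 : ∀ x ∈ X, ∀ y ∈ Y, ∀ y' ∈ Y, ¬H.Adj x y → ¬H.Adj x y' → y = y')
    (hm2 : ∀ y ∈ Y, ∀ x ∈ X, ∀ x' ∈ X, ¬H.Adj x y → ¬H.Adj x' y → x = x')
    (L : V → Finset ℕ)
    (hLX : ∀ x ∈ X, X.ncard ≤ (L x).card)
    (hLY : ∀ y ∈ Y, Y.ncard ≤ (L y).card) :
    ListColorable H L := by
  classical
  have hex : ∀ x ∈ X, ∃ y, y ∈ Y ∧ ¬H.Adj x y := by
    have hinj : Set.InjOn Prod.fst {p : V × V | p.1 ∈ X ∧ p.2 ∈ Y ∧ ¬H.Adj p.1 p.2} := by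
      rintro ⟨a, b⟩ ⟨h1, h2, h3⟩ ⟨a', b'⟩ ⟨h1', h2', h3'⟩ h
      simp only at h h1 h2 h3 h1' h2' h3'
      subst h
      rw [hm1 a h1 b h2 b' h2' h3 h3']
    have himg : Prod.fst '' {p : V × V | p.1 ∈ X ∧ p.2 ∈ Y ∧ ¬H.Adj p.1 p.2} = X := by
      apply Set.eq_of_subset_of_ncard_le
      · rintro _ ⟨p, hp, rfl⟩
        exact hp.1
      · rw [Set.ncard_image_of_injOn hinj, hcount]
      · exact Set.toFinite _
    intro x hx
    rw [← himg] at hx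
    obtain ⟨p, hp, rfl⟩ := hx
    exact ⟨p.2, hp.2⟩
  choose! f hf using hex
  rw [Set.ncard_eq_toFinset_card'] at hle hLX hLY
  rw [Set.ncard_eq_toFinset_card'] at hle
  obtain ⟨c, hc1, hc2⟩ := cml_aux f _ X.toFinset Y.toFinset L rfl
    (by simpa using hdisj) hle (by simpa using fun x hx => (hf x hx).1)
    (by
      intro x hx x' hx' h
      rw [Set.mem_toFinset] at hx hx'
      exact hm2 (f x) (hf x hx).1 x hx x' hx' (hf x hx).2 (h ▸ (hf x' hx').2))
    (by simpa using hLX) (by simpa using hLY)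
  have hall : ∀ v, v ∈ X.toFinset ∪ Y.toFinset := by
    intro v
    have : v ∈ X ∪ Y := hcover ▸ Set.mem_univ v
    simpa using this
  refine ⟨c, fun v => hc1 v (hall v), ?_⟩
  intro u w huw h
  rcases hc2 u (hall u) w (hall w) h with h | ⟨h2, rfl⟩ | ⟨h2, rfl⟩
  · exact huw.ne h
  · exact (hf u (by simpa using h2)).2 huw
  · exact (hf w (by simpa using h2)).2 huw.symm
end

section
/- Let H be a graph on four vertices x_1, x_2, y_1, y_2 in which every pair of distinct vertices is adjacent except the single pair {x_2, y_2}. Let L be a list assignment on V(H) with |L(u)| ≥ 2 for every vertex u. Then H admits an L-coloring if and only if every clique Q of H satisfies |⋃_{v ∈ Q} L(v)| ≥ |Q|. -/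
open SimpleGraph

variable {V : Type*}

theorem aux_bad (C : Finset ℕ) (hC : 2 ≤ C.card) (a b : ℕ)
    (h : ∀ c ∈ C, c = a ∨ c = b) : C = {a, b} := by
  apply Finset.eq_of_subset_of_card_le
  · intro c hc
    simpa using h c hc
  · exact le_trans Finset.card_le_two hC

theorem aux_three (C D : Finset ℕ) (p q r : Finset ℕ) (hpq : p ≠ q) (hpr : p ≠ r) (hqr : q ≠ r)
    (h1 : C = p ∨ D = p) (h2 : C = q ∨ D = q) (h3 : C = r ∨ D = r) : False := by
  grind

theorem aux_pair_ne (a b c d x : ℕ) (h : x = a ∨ x = b) (h1 : x ≠ c) (h2 : x ≠ d) :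
    ({a, b} : Finset ℕ) ≠ {c, d} := by
  intro e
  have : x ∈ ({a, b} : Finset ℕ) := by simpa using h
  rw [e] at this
  simp at this
  tauto

theorem aux_half (A B C D : Finset ℕ) (hA : 2 ≤ A.card) (hB : 2 ≤ B.card)
    (hbad : ∀ a ∈ A, ∀ b ∈ B, a ≠ b → C = {a, b} ∨ D = {a, b}) : B ⊆ A := by
  intro b hb
  by_contra hbA
  obtain ⟨a1, h1, a2, h2, h12⟩ := Finset.one_lt_card.mp hA
  obtain ⟨b', hb', hbb⟩ := Finset.exists_mem_ne hB b
  have key : ∀ a1 ∈ A, ∀ a2 ∈ A, a1 ≠ a2 → a1 ≠ b' → False := by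
    intro a1 h1 a2 h2 h12 h1b
    have n1 : a1 ≠ b := by rintro rfl; exact hbA h1
    have n2 : a2 ≠ b := by rintro rfl; exact hbA h2
    exact aux_three C D {a1, b} {a2, b} {a1, b'}
      (aux_pair_ne _ _ _ _ a1 (by simp) h12 n1)
      (aux_pair_ne _ _ _ _ b (by simp) n1.symm hbb.symm)
      (aux_pair_ne _ _ _ _ b (by simp) n1.symm hbb.symm)
      (hbad _ h1 _ hb n1) (hbad _ h2 _ hb n2) (hbad _ h1 _ hb' h1b)
  by_cases h : a1 = b'
  · exact key a2 h2 a1 h1 h12.symm (by rw [← h]; exact h12.symm)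
  · exact key a1 h1 a2 h2 h12 h

theorem aux_main (A B C D : Finset ℕ) (hA : 2 ≤ A.card) (hB : 2 ≤ B.card)
    (hC : 2 ≤ C.card) (hD : 2 ≤ D.card)
    (h1 : 3 ≤ (A ∪ B ∪ C).card) (h2 : 3 ≤ (A ∪ B ∪ D).card) :
    ∃ a ∈ A, ∃ b ∈ B, ∃ c ∈ C, ∃ d ∈ D, a ≠ b ∧ c ≠ a ∧ c ≠ b ∧ d ≠ a ∧ d ≠ b := by
  by_contra hcon
  have hbad : ∀ a ∈ A, ∀ b ∈ B, a ≠ b → C = {a, b} ∨ D = {a, b} := by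
    intro a ha b hb hab
    by_contra hn
    push Not at hn
    have hc : ∃ c ∈ C, c ≠ a ∧ c ≠ b := by
      by_contra h
      exact hn.1 (aux_bad C hC a b (fun c hc => by by_contra h'; exact h ⟨c, hc, by tauto⟩))
    have hd : ∃ c ∈ D, c ≠ a ∧ c ≠ b := by
      by_contra h
      exact hn.2 (aux_bad D hD a b (fun c hc => by by_contra h'; exact h ⟨c, hc, by tauto⟩))
    obtain ⟨c, hc, hc'⟩ := hc
    obtain ⟨d, hd, hd'⟩ := hd
    exact hcon ⟨a, ha, b, hb, c, hc, d, hd, hab, hc'.1, hc'.2, hd'.1, hd'.2⟩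
  have hBA := aux_half A B C D hA hB hbad
  have hAB := aux_half B A C D hB hA (fun b hb a ha hab => by
    rw [Finset.pair_comm]; exact hbad a ha b hb hab.symm)
  obtain rfl : A = B := Finset.Subset.antisymm hAB hBA
  by_cases h3 : 3 ≤ A.card
  · obtain ⟨x, y, z, hx, hy, hz, hxy, hxz, hyz⟩ := Finset.two_lt_card_iff.mp h3
    exact aux_three C D {x, y} {x, z} {y, z}
      (aux_pair_ne _ _ _ _ y (by simp) hxy.symm hyz)
      (aux_pair_ne _ _ _ _ x (by simp) hxy hxz)
      (aux_pair_ne _ _ _ _ x (by simp) hxy hxz)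
      (hbad _ hx _ hy hxy) (hbad _ hx _ hz hxz) (hbad _ hy _ hz hyz)
  · obtain ⟨x, y, hxy, rfl⟩ := Finset.card_eq_two.mp (show A.card = 2 by omega)
    have h2' : ({x, y} : Finset ℕ).card ≤ 2 := Finset.card_le_two
    rcases hbad x (by simp) y (by simp) hxy with rfl | rfl
    · simp only [Finset.union_idempotent] at h1; omega
    · simp only [Finset.union_idempotent] at h2; omega

/-- For the complete graph on `{x₁, x₂, y₁, y₂}` minus the single edge
`x₂y₂`, with all lists of size at least 2, an `L`-coloring exists iff every clique `Q`
satisfies `|L(Q)| ≥ |Q|`. -/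
theorem list_colorable_iff_hall_x2y2
    {V : Type*} [DecidableEq V] (H : SimpleGraph V) (x1 x2 y1 y2 : V)
    (hnodup : [x1, x2, y1, y2].Nodup)
    (huniv : ∀ v : V, v = x1 ∨ v = x2 ∨ v = y1 ∨ v = y2)
    (hadj : ∀ u v : V, H.Adj u v ↔
      u ≠ v ∧ ¬(u = x2 ∧ v = y2) ∧ ¬(u = y2 ∧ v = x2))
    (L : V → Finset ℕ) (hL : ∀ u : V, 2 ≤ (L u).card) :
    ListColorable H L ↔
      ∀ Q : Finset V, H.IsClique (Q : Set V) → Q.card ≤ (Q.biUnion L).card := by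
  constructor
  · rintro ⟨c, hc, hp⟩ Q hQ
    apply Finset.card_le_card_of_injOn c
    · intro v hv
      exact Finset.mem_coe.mpr (Finset.mem_biUnion.mpr ⟨v, hv, hc v⟩)
    · intro u hu v hv huv
      by_contra hne
      exact hp (hQ hu hv hne) huv
  · intro h
    simp only [List.nodup_cons, List.mem_cons, List.not_mem_nil, or_false, not_or] at hnodup
    obtain ⟨⟨n12, n13, n14⟩, ⟨n23, n24⟩, n34, -⟩ := hnodup
    have e1 : 3 ≤ (L x1 ∪ L y1 ∪ L x2).card := by
      have := h {x1, y1, x2} (by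
        intro u hu v hv huv
        simp only [Finset.coe_insert, Finset.coe_singleton, Set.mem_insert_iff,
          Set.mem_singleton_iff] at hu hv
        rw [hadj]
        grind)
      rw [Finset.card_eq_three.mpr ⟨x1, y1, x2, n13, n12, Ne.symm n23, rfl⟩] at this
      simpa [Finset.biUnion_insert, Finset.union_assoc] using this
    have e2 : 3 ≤ (L x1 ∪ L y1 ∪ L y2).card := by
      have := h {x1, y1, y2} (by
        intro u hu v hv huv
        simp only [Finset.coe_insert, Finset.coe_singleton, Set.mem_insert_iff,
          Set.mem_singleton_iff] at hu hv
        rw [hadj]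
        grind)
      rw [Finset.card_eq_three.mpr ⟨x1, y1, y2, n13, n14, n34, rfl⟩] at this
      simpa [Finset.biUnion_insert, Finset.union_assoc] using this
    obtain ⟨a, ha, b, hb, c, hc, d, hd, hab, hca, hcb, hda, hdb⟩ :=
      aux_main _ _ _ _ (hL x1) (hL y1) (hL x2) (hL y2) e1 e2
    refine ⟨fun v => if v = x1 then a else if v = y1 then b else if v = x2 then c else d, ?_, ?_⟩
    · intro v
      have := huniv v
      grind
    · intro u v huv
      rw [hadj] at huv
      have hu := huniv u
      have hv := huniv v
      grind
end

section
/- Let H be a graph on five vertices x_1, x_2, x_3, y_1, y_2 in which every pair of distinct vertices is adjacent except the single pair {x_3, y_2}. Let L be a list assignment on V(H) such that |L(x_i)| ≥ 3 for i = 1, 2, 3 and |L(y_j)| ≥ 2 for j = 1, 2. Then H admits an L-coloring if and only if every clique Q of H satisfies |⋃_{v ∈ Q} L(v)| ≥ |Q|. -/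
open SimpleGraph

variable {V : Type*}

theorem aux_ne (A : Finset ℕ) (h : 2 ≤ A.card) (x : ℕ) : ∃ a ∈ A, a ≠ x := by
  have : 0 < (A.erase x).card := by
    have := Finset.pred_card_le_card_erase (s := A) (a := x)
    omega
  obtain ⟨a, ha⟩ := Finset.card_pos.1 this
  exact ⟨a, Finset.mem_of_mem_erase ha, Finset.ne_of_mem_erase ha⟩

theorem aux_ne2 (A : Finset ℕ) (h : 3 ≤ A.card) (x y : ℕ) : ∃ a ∈ A, a ≠ x ∧ a ≠ y := by
  have h2 : 2 ≤ (A.erase x).card := by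
    have := Finset.pred_card_le_card_erase (s := A) (a := x)
    omega
  obtain ⟨a, ha, hy⟩ := aux_ne _ h2 y
  exact ⟨a, Finset.mem_of_mem_erase ha, Finset.ne_of_mem_erase ha, hy⟩

theorem aux_sdr (A B D : Finset ℕ) (hA : 2 ≤ A.card) (hB : 2 ≤ B.card) (hD : 1 ≤ D.card)
    (hU : 3 ≤ (A ∪ B ∪ D).card) :
    ∃ a ∈ A, ∃ b ∈ B, ∃ d ∈ D, a ≠ b ∧ a ≠ d ∧ b ≠ d := by
  by_cases h1 : ∃ d ∈ D, d ∉ A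
  · obtain ⟨d, hd, hdA⟩ := h1
    obtain ⟨b, hb, hbd⟩ := aux_ne B hB d
    obtain ⟨a, ha, hab⟩ := aux_ne A hA b
    exact ⟨a, ha, b, hb, d, hd, hab, fun h => hdA (h ▸ ha), hbd⟩
  by_cases h2 : ∃ d ∈ D, d ∉ B
  · obtain ⟨d, hd, hdB⟩ := h2
    obtain ⟨a, ha, had⟩ := aux_ne A hA d
    obtain ⟨b, hb, hba⟩ := aux_ne B hB a
    exact ⟨a, ha, b, hb, d, hd, hba.symm, had, fun h => hdB (h ▸ hb)⟩
  push Not at h1 h2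
  obtain ⟨d, hd⟩ := Finset.card_pos.1 hD
  by_cases h3 : ∃ z ∈ A, z ∉ B
  · obtain ⟨z, hz, hzB⟩ := h3
    obtain ⟨b, hb, hbd⟩ := aux_ne B hB d
    exact ⟨z, hz, b, hb, d, hd, fun h => hzB (h ▸ hb), fun h => hzB (h ▸ h2 d hd), hbd⟩
  push Not at h3
  have hB3 : 3 ≤ B.card := by
    refine hU.trans (Finset.card_le_card ?_)
    intro x hx
    simp only [Finset.mem_union] at hx
    rcases hx with (hx | hx) | hx
    · exact h3 x hx
    · exact hx
    · exact h2 x hx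
  obtain ⟨a, ha, had⟩ := aux_ne A hA d
  obtain ⟨b, hb, hba, hbd⟩ := aux_ne2 B hB3 a d
  exact ⟨a, ha, b, hb, d, hd, hba.symm, had, hbd⟩

/-- For the complete graph on `{x₁, x₂, x₃, y₁, y₂}` minus the single
edge `x₃y₂`, with `|L(xᵢ)| ≥ 3` and `|L(yⱼ)| ≥ 2`, an `L`-coloring exists iff every
clique `Q` satisfies `|L(Q)| ≥ |Q|`. -/
theorem list_colorable_iff_hall_x3y2
    {V : Type*} [DecidableEq V] (H : SimpleGraph V) (x1 x2 x3 y1 y2 : V)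
    (hnodup : [x1, x2, x3, y1, y2].Nodup)
    (huniv : ∀ v : V, v = x1 ∨ v = x2 ∨ v = x3 ∨ v = y1 ∨ v = y2)
    (hadj : ∀ u v : V, H.Adj u v ↔
      u ≠ v ∧ ¬(u = x3 ∧ v = y2) ∧ ¬(u = y2 ∧ v = x3))
    (L : V → Finset ℕ)
    (hLx1 : 3 ≤ (L x1).card) (hLx2 : 3 ≤ (L x2).card) (hLx3 : 3 ≤ (L x3).card)
    (hLy1 : 2 ≤ (L y1).card) (hLy2 : 2 ≤ (L y2).card) :
    ListColorable H L ↔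
      ∀ Q : Finset V, H.IsClique (Q : Set V) → Q.card ≤ (Q.biUnion L).card := by
  have hn := hnodup
  simp only [List.nodup_cons, List.mem_cons, List.not_mem_nil, or_false, not_or,
    not_false_eq_true, List.nodup_nil, and_true] at hn
  obtain ⟨⟨n12, n13, n14, n15⟩, ⟨n23, n24, n25⟩, ⟨n34, n35⟩, n45⟩ := hn
  constructor
  · rintro ⟨c, hc, hp⟩ Q hQ
    refine Finset.card_le_card_of_injOn c ?_ ?_
    · intro v hv
      exact Finset.mem_coe.2 (Finset.mem_biUnion.2 ⟨v, hv, hc v⟩)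
    · intro u hu v hv huv
      by_contra hne
      exact hp (hQ hu hv hne) huv
  intro hall
  have key : ∀ a ∈ L x1, ∀ b ∈ L x2, ∀ p ∈ L x3, ∀ d ∈ L y1, ∀ q ∈ L y2,
      a ≠ b → a ≠ p → a ≠ d → a ≠ q → b ≠ p → b ≠ d → b ≠ q → p ≠ d → d ≠ q →
      ListColorable H L := by
    intro a ha b hb p hp d hd q hq h1 h2 h3 h4 h5 h6 h7 h8 h9
    let c : V → ℕ := fun v => if v = x1 then a else if v = x2 then b else
      if v = x3 then p else if v = y1 then d else q
    have c1 : c x1 = a := by simp [c]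
    have c2 : c x2 = b := by simp [c, Ne.symm n12]
    have c3 : c x3 = p := by simp [c, Ne.symm n13, Ne.symm n23]
    have c4 : c y1 = d := by simp [c, Ne.symm n14, Ne.symm n24, Ne.symm n34]
    have c5 : c y2 = q := by simp [c, Ne.symm n15, Ne.symm n25, Ne.symm n35, Ne.symm n45]
    clear_value c
    refine ⟨c, ?_, ?_⟩
    · intro v
      rcases huniv v with rfl | rfl | rfl | rfl | rfl <;> simp_all
    · intro u w huw
      obtain ⟨e1, e2, e3⟩ := (hadj u w).1 huw
      clear hadj hall huw hnodup
      rcases huniv u with hu | hu | hu | hu | hu <;>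
      rcases huniv w with hw | hw | hw | hw | hw <;>
      rw [hu, hw] <;> simp only [c1, c2, c3, c4, c5] <;>
      first
        | assumption
        | exact Ne.symm (by assumption)
        | exact absurd (hu.trans hw.symm) e1
        | exact (e2 ⟨hu, hw⟩).elim
        | exact (e3 ⟨hu, hw⟩).elim
  have cl : ∀ Q : Finset V, ¬ (x3 ∈ Q ∧ y2 ∈ Q) → Q.card ≤ (Q.biUnion L).card := by
    intro Q hQ
    apply hall
    intro u hu v hv huv
    refine (hadj u v).2 ⟨huv, ?_, ?_⟩
    · rintro ⟨rfl, rfl⟩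
      exact hQ ⟨hu, hv⟩
    · rintro ⟨rfl, rfl⟩
      exact hQ ⟨hv, hu⟩
  have sub1 : L x1 ⊆ L x1 ∪ L x2 ∪ L y1 := by
    intro x hx; simp [hx]
  have sub2 : L x2 ⊆ L x1 ∪ L x2 ∪ L y1 := by
    intro x hx; simp [hx]
  have sub3 : L y1 ⊆ L x1 ∪ L x2 ∪ L y1 := by
    intro x hx; simp [hx]
  by_cases hU : (L x1 ∪ L x2 ∪ L y1).card ≤ 3
  · have hp : ∃ p ∈ L x3, p ∉ L x1 ∪ L x2 ∪ L y1 := by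
      by_contra hcon
      push Not at hcon
      have h4 := cl {x1, x2, x3, y1} (by simp [Ne.symm n15, Ne.symm n25, Ne.symm n35, Ne.symm n45])
      have e : ({x1, x2, x3, y1} : Finset V).card = 4 := by
        simp [n12, n13, n14, n23, n24, n34]
      have : (({x1, x2, x3, y1} : Finset V).biUnion L) ⊆ L x1 ∪ L x2 ∪ L y1 := by
        intro x hx
        simp only [Finset.mem_biUnion, Finset.mem_insert, Finset.mem_singleton] at hx
        obtain ⟨v, rfl | rfl | rfl | rfl, hx⟩ := hx
        · exact sub1 hx
        · exact sub2 hx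
        · exact hcon x hx
        · exact sub3 hx
      have := Finset.card_le_card this
      omega
    have hq : ∃ q ∈ L y2, q ∉ L x1 ∪ L x2 ∪ L y1 := by
      by_contra hcon
      push Not at hcon
      have h4 := cl {x1, x2, y2, y1} (by simp [Ne.symm n13, Ne.symm n23, n35, n34])
      have e : ({x1, x2, y2, y1} : Finset V).card = 4 := by
        simp [n12, n15, n14, n25, n24, Ne.symm n45]
      have : (({x1, x2, y2, y1} : Finset V).biUnion L) ⊆ L x1 ∪ L x2 ∪ L y1 := by
        intro x hx
        simp only [Finset.mem_biUnion, Finset.mem_insert, Finset.mem_singleton] at hx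
        obtain ⟨v, rfl | rfl | rfl | rfl, hx⟩ := hx
        · exact sub1 hx
        · exact sub2 hx
        · exact hcon x hx
        · exact sub3 hx
      have := Finset.card_le_card this
      omega
    obtain ⟨p, hp, hpU⟩ := hp
    obtain ⟨q, hq, hqU⟩ := hq
    obtain ⟨a, ha, b, hb, d, hd, hab, had, hbd⟩ := aux_sdr (L x1) (L x2) (L y1) (by omega)
      (by omega) (by omega) (hLx1.trans (Finset.card_le_card sub1))
    exact key a ha b hb p hp d hd q hq hab (fun h => hpU (h ▸ sub1 ha)) had
      (fun h => hqU (h ▸ sub1 ha)) (fun h => hpU (h ▸ sub2 hb)) hbd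
      (fun h => hqU (h ▸ sub2 hb)) (fun h => hpU (h ▸ sub3 hd)) (fun h => hqU (h ▸ sub3 hd))
  push Not at hU
  by_cases hCE : Disjoint (L x3) (L y2)
  · have hh : ∀ s : Finset V, s.card ≤ (s.biUnion L).card := by
      intro s
      by_cases hs : x3 ∈ s ∧ y2 ∈ s
      · have h5 : s.card ≤ 5 := by
          have : s ⊆ {x1, x2, x3, y1, y2} := by
            intro v _
            simpa using huniv v
          exact (Finset.card_le_card this).trans Finset.card_le_five
        have : L x3 ∪ L y2 ⊆ s.biUnion L :=
          Finset.union_subset (Finset.subset_biUnion_of_mem L hs.1)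
            (Finset.subset_biUnion_of_mem L hs.2)
        have := Finset.card_le_card this
        rw [Finset.card_union_of_disjoint hCE] at this
        omega
      · exact cl s hs
    obtain ⟨f, hf, hfm⟩ := (Finset.all_card_le_biUnion_card_iff_exists_injective L).1 hh
    exact ⟨f, hfm, fun u w huw h => huw.ne (hf h)⟩
  · obtain ⟨c, hc3, hc5⟩ := Finset.not_disjoint_iff.1 hCE
    have e1 := Finset.pred_card_le_card_erase (s := L x1) (a := c)
    have e2 := Finset.pred_card_le_card_erase (s := L x2) (a := c)
    have e3 := Finset.pred_card_le_card_erase (s := L y1) (a := c)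
    have e4 := Finset.pred_card_le_card_erase (s := L x1 ∪ L x2 ∪ L y1) (a := c)
    rw [Finset.erase_union_distrib, Finset.erase_union_distrib] at e4
    obtain ⟨a, ha, b, hb, d, hd, hab, had, hbd⟩ := aux_sdr ((L x1).erase c) ((L x2).erase c)
      ((L y1).erase c) (by omega) (by omega) (by omega) (by omega)
    rw [Finset.mem_erase] at ha hb hd
    exact key a ha.2 b hb.2 c hc3 d hd.2 c hc5 hab ha.1 had ha.1 hb.1 hbd hb.1 hd.1.symm hd.1
end

section
/- Let H be a graph on six vertices x_1, x_2, x_3, y_1, y_2, y_3 in which every pair of distinct vertices is adjacent except exactly the two pairs {x_2, y_2} and {x_3, y_3}. Let L be a list assignment on V(H) with |L(v)| ≥ 3 for every vertex v. Then H admits an L-coloring if and only if every clique Q of H satisfies |⋃_{v ∈ Q} L(v)| ≥ |Q|. In particular, if |L(x_1) ∪ L(y_1)| ≥ 4, then H admits an L-coloring. -/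
open SimpleGraph

variable {V : Type*}

def Col6 (A B X2 X3 Y2 Y3 : Finset ℕ) : Prop :=
  ∃ a ∈ A, ∃ b ∈ B, ∃ p ∈ X2, ∃ r ∈ X3, ∃ q ∈ Y2, ∃ s ∈ Y3,
    a ≠ b ∧ a ≠ p ∧ a ≠ q ∧ a ≠ r ∧ a ≠ s ∧ b ≠ p ∧ b ≠ q ∧ b ≠ r ∧ b ≠ s ∧
    p ≠ r ∧ p ≠ s ∧ q ≠ r ∧ q ≠ s

lemma Col6.swap3 {A B X2 X3 Y2 Y3 : Finset ℕ} (h : Col6 A B X2 Y3 Y2 X3) :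
    Col6 A B X2 X3 Y2 Y3 := by
  obtain ⟨a, ha, b, hb, p, hp, r, hr, q, hq, s, hs, h⟩ := h
  exact ⟨a, ha, b, hb, p, hp, s, hs, q, hq, r, hr, by tauto⟩

lemma Col6.swap23 {A B X2 X3 Y2 Y3 : Finset ℕ} (h : Col6 A B X3 X2 Y3 Y2) :
    Col6 A B X2 X3 Y2 Y3 := by
  obtain ⟨a, ha, b, hb, p, hp, r, hr, q, hq, s, hs, h⟩ := h
  refine ⟨a, ha, b, hb, r, hr, p, hp, s, hs, q, hq, ?_⟩
  have := fun x y : ℕ => (ne_comm : x ≠ y ↔ y ≠ x)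
  grind

lemma exists_out {S T : Finset ℕ} (hS : S.card ≤ 3) (h : 4 ≤ (S ∪ T).card) :
    ∃ p ∈ T, p ∉ S := by
  by_contra! hc
  have : S ∪ T = S := Finset.union_eq_left.2 hc
  rw [this] at h; omega

lemma exists_two {S : Finset ℕ} (c : ℕ) (hS : 3 ≤ S.card) :
    ∃ a ∈ S, ∃ b ∈ S, a ≠ b ∧ a ≠ c ∧ b ≠ c := by
  have : 1 < (S.erase c).card := by
    have := Finset.pred_card_le_card_erase (s := S) (a := c); omega
  obtain ⟨a, ha, b, hb, hab⟩ := Finset.one_lt_card.1 this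
  simp only [Finset.mem_erase] at ha hb
  exact ⟨a, ha.2, b, hb.2, hab, ha.1, hb.1⟩

lemma exists_av {S : Finset ℕ} (p q : ℕ) (hS : 3 ≤ S.card) :
    ∃ s ∈ S, s ≠ p ∧ s ≠ q := by
  obtain ⟨a, ha, b, hb, hab, h1, h2⟩ := exists_two p hS
  by_cases h : a = q
  · exact ⟨b, hb, h2, fun h' => hab (h.trans h'.symm)⟩
  · exact ⟨a, ha, h1, h⟩

lemma sdr4 (A B X Y : Finset ℕ) (hA : 2 ≤ A.card) (hB : 2 ≤ B.card) (hX : 2 ≤ X.card)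
    (hY : 2 ≤ Y.card) (hd : Disjoint X Y) (h1 : 3 ≤ (A ∪ B ∪ X).card)
    (h2 : 3 ≤ (A ∪ B ∪ Y).card) :
    ∃ a ∈ A, ∃ b ∈ B, ∃ r ∈ X, ∃ s ∈ Y,
      a ≠ b ∧ a ≠ r ∧ a ≠ s ∧ b ≠ r ∧ b ≠ s ∧ r ≠ s := by
  have key := (Finset.all_card_le_biUnion_card_iff_exists_injective ![A, B, X, Y]).1 (by
    intro s
    have hXY : 4 ≤ (X ∪ Y).card := by rw [Finset.card_union_of_disjoint hd]; omega
    by_cases h23 : (2 : Fin 4) ∈ s ∧ (3 : Fin 4) ∈ s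
    · have hsub : X ∪ Y ⊆ s.biUnion ![A, B, X, Y] := Finset.union_subset
        (Finset.subset_biUnion_of_mem ![A, B, X, Y] h23.1)
        (Finset.subset_biUnion_of_mem ![A, B, X, Y] h23.2)
      have := Finset.card_le_card hsub
      have h4 := Finset.card_le_univ s
      simp at h4; omega
    · by_cases hs : s.card ≤ 2
      · rcases s.eq_empty_or_nonempty with rfl | ⟨i, hi⟩
        · simp
        · have := Finset.card_le_card (Finset.subset_biUnion_of_mem ![A, B, X, Y] hi)
          have h2 : 2 ≤ (![A, B, X, Y] i).card := by fin_cases i <;> simpa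
          omega
      · have : s = {0, 1, 2} ∨ s = {0, 1, 3} := by
          clear h1 h2 hd hXY; revert s; decide
        rcases this with rfl | rfl
        · simpa [Finset.biUnion_insert, ← Finset.union_assoc] using h1
        · simpa [Finset.biUnion_insert, ← Finset.union_assoc] using h2)
  obtain ⟨f, hf, hm⟩ := key
  exact ⟨f 0, hm 0, f 1, hm 1, f 2, hm 2, f 3, hm 3, hf.ne (by decide), hf.ne (by decide),
    hf.ne (by decide), hf.ne (by decide), hf.ne (by decide), hf.ne (by decide)⟩

/-- the exceptional triple -/
lemma col_fail {A B X2 X3 Y2 Y3 : Finset ℕ} {c : ℕ}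
    (hA : 3 ≤ A.card) (hB : 3 ≤ B.card) (hX3 : 3 ≤ X3.card) (hY3 : 3 ≤ Y3.card)
    (h1 : 4 ≤ (A ∪ B ∪ X3 ∪ X2).card) (h2 : 4 ≤ (A ∪ B ∪ X3 ∪ Y2).card)
    (hd : ∀ d ∈ X3, d ∈ Y3 → d = c)
    (hf : ((A ∪ B ∪ X3).erase c).card ≤ 2) : Col6 A B X2 X3 Y2 Y3 := by
  obtain ⟨S, hS⟩ : ∃ S, S = A ∪ B ∪ X3 := ⟨_, rfl⟩
  rw [← hS] at h1 h2 hf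
  have hcS : S.card ≤ 3 := by
    have := Finset.pred_card_le_card_erase (s := S) (a := c); omega
  have eA : A = S := Finset.eq_of_subset_of_card_le (by rw [hS]; grind) (by omega)
  have eB : B = S := Finset.eq_of_subset_of_card_le (by rw [hS]; grind) (by omega)
  have eX : X3 = S := Finset.eq_of_subset_of_card_le (by rw [hS]; grind) (by omega)
  clear hS
  subst eA
  subst eB
  subst eX
  have hc : c ∈ X3 := by
    by_contra hc
    rw [Finset.erase_eq_of_notMem hc] at hf; omega
  obtain ⟨p, hp, hpS⟩ := exists_out hcS h1
  obtain ⟨q, hq, hqS⟩ := exists_out hcS h2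
  obtain ⟨a, ha, b, hb, hab, hac, hbc⟩ := exists_two c hX3
  by_cases hcY : c ∈ Y3
  · exact ⟨a, ha, b, hb, p, hp, c, hc, q, hq, c, hcY, by grind⟩
  · obtain ⟨s, hs, hsp, hsq⟩ := exists_av p q hY3
    exact ⟨a, ha, b, hb, p, hp, c, hc, q, hq, s, hs, by grind⟩

lemma col_out {S X2 X3 Y2 Y3 : Finset ℕ} {c p q : ℕ} (hS : 3 ≤ S.card)
    (hc : c ∈ S) (hX : c ∈ X2) (hY : c ∈ Y2) (hp : p ∈ X3) (hq : q ∈ Y3)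
    (hp' : p ∉ S) (hq' : q ∉ S) : Col6 S S X2 X3 Y2 Y3 := by
  obtain ⟨a, ha, b, hb, hab, hac, hbc⟩ := exists_two c hS
  exact ⟨a, ha, b, hb, c, hX, p, hp, c, hY, q, hq, by grind⟩

lemma col_cd {A B X2 X3 Y2 Y3 : Finset ℕ} {c d : ℕ} (hA : 3 ≤ A.card) (hB : 3 ≤ B.card)
    (hcd : d ≠ c) (hcX : c ∈ X2) (hcY : c ∈ Y2) (hdX : d ∈ X3) (hdY : d ∈ Y3)
    (h22 : 4 ≤ (A ∪ B ∪ X2 ∪ X3).card) (h23 : 4 ≤ (A ∪ B ∪ X2 ∪ Y3).card)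
    (h32 : 4 ≤ (A ∪ B ∪ Y2 ∪ X3).card) (h33 : 4 ≤ (A ∪ B ∪ Y2 ∪ Y3).card) :
    Col6 A B X2 X3 Y2 Y3 := by
  by_cases hex : ∃ a ∈ A, ∃ b ∈ B, a ≠ b ∧ a ≠ c ∧ a ≠ d ∧ b ≠ c ∧ b ≠ d
  · obtain ⟨a, ha, b, hb, h⟩ := hex
    exact ⟨a, ha, b, hb, c, hcX, d, hdX, c, hcY, d, hdY, by grind⟩
  push Not at hex
  obtain ⟨e, he, hec, hed⟩ := exists_av c d hA
  obtain ⟨e', he', hec', hed'⟩ := exists_av c d hB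
  have hSc : ({c, d, e} : Finset ℕ).card ≤ 3 := Finset.card_le_three
  have eB : B = {c, d, e} := Finset.eq_of_subset_of_card_le (by
    intro x hx; have := hex e he x hx; simp; grind) (by omega)
  have eA : A = {c, d, e} := Finset.eq_of_subset_of_card_le (by
    intro x hx
    have h1 := hex x hx e' he'
    have h2 := hex e he e' he'
    simp; grind) (by omega)
  obtain ⟨S, hS⟩ : ∃ S : Finset ℕ, S = {c, d, e} := ⟨_, rfl⟩
  have hcS : c ∈ S := by simp [hS]
  have hdS : d ∈ S := by simp [hS]
  rw [← hS] at eA eB hSc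
  subst eA
  subst eB
  simp only [Finset.union_self] at *
  have out : ∀ P Q : Finset ℕ, 4 ≤ (B ∪ P ∪ Q).card → (∃ p ∈ P, p ∉ B) ∨ ∃ p ∈ Q, p ∉ B := by
    intro P Q h
    rw [Finset.union_assoc] at h
    obtain ⟨p, hp, hpS⟩ := exists_out hSc h
    rcases Finset.mem_union.1 hp with h | h
    · exact Or.inl ⟨p, h, hpS⟩
    · exact Or.inr ⟨p, h, hpS⟩
  have o1 := out _ _ h22
  have o2 := out _ _ h23
  have o3 := out _ _ h32
  have o4 := out _ _ h33
  have : ((∃ p ∈ X3, p ∉ B) ∧ ∃ p ∈ Y3, p ∉ B) ∨ ((∃ p ∈ X2, p ∉ B) ∧ ∃ p ∈ Y2, p ∉ B) := by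
    clear out hS hex hSc h22 h23 h32 h33
    generalize (∃ p ∈ X3, p ∉ B) = P1 at *
    generalize (∃ p ∈ Y3, p ∉ B) = P2 at *
    generalize (∃ p ∈ X2, p ∉ B) = P3 at *
    generalize (∃ p ∈ Y2, p ∉ B) = P4 at *
    grind
  rcases this with ⟨⟨p, hp, hp'⟩, q, hq, hq'⟩ | ⟨⟨p, hp, hp'⟩, q, hq, hq'⟩
  · exact col_out hA hcS hcX hcY hp hq hp' hq'
  · exact (col_out hA hdS hdX hdY hp hq hp' hq').swap23

lemma col_c {A B X2 X3 Y2 Y3 : Finset ℕ} {c : ℕ} (hA : 3 ≤ A.card) (hB : 3 ≤ B.card)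
    (hX3 : 3 ≤ X3.card) (hY3 : 3 ≤ Y3.card)
    (hcX : c ∈ X2) (hcY : c ∈ Y2)
    (h22 : 4 ≤ (A ∪ B ∪ X2 ∪ X3).card) (h23 : 4 ≤ (A ∪ B ∪ X2 ∪ Y3).card)
    (h32 : 4 ≤ (A ∪ B ∪ Y2 ∪ X3).card) (h33 : 4 ≤ (A ∪ B ∪ Y2 ∪ Y3).card) :
    Col6 A B X2 X3 Y2 Y3 := by
  by_cases hd : ∃ d ∈ X3, d ∈ Y3 ∧ d ≠ c
  · obtain ⟨d, h1, h2, h3⟩ := hd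
    exact col_cd hA hB h3 hcX hcY h1 h2 h22 h23 h32 h33
  have hd' : ∀ d ∈ X3, d ∈ Y3 → d = c := by
    intro d h1 h2; by_contra h; exact hd ⟨d, h1, h2, h⟩
  by_cases hf : ((A ∪ B ∪ X3).erase c).card ≤ 2
  · exact col_fail hA hB hX3 hY3 (by rwa [Finset.union_right_comm])
      (by rwa [Finset.union_right_comm]) hd' hf
  by_cases hf' : ((A ∪ B ∪ Y3).erase c).card ≤ 2
  · exact (col_fail hA hB hY3 hX3 (by rwa [Finset.union_right_comm])
      (by rwa [Finset.union_right_comm]) (fun d h1 h2 => hd' d h2 h1) hf').swap3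
  have er : ∀ S : Finset ℕ, 3 ≤ S.card → 2 ≤ (S.erase c).card := by
    intro S hS
    have := Finset.pred_card_le_card_erase (s := S) (a := c); omega
  rw [Finset.erase_union_distrib, Finset.erase_union_distrib] at hf hf'
  obtain ⟨a, ha, b, hb, r, hr, s, hs, h⟩ := sdr4 (A.erase c) (B.erase c) (X3.erase c) (Y3.erase c)
    (er _ hA) (er _ hB) (er _ hX3) (er _ hY3)
    (by rw [Finset.disjoint_left]; intro x h1 h2; grind) (by omega) (by omega)
  simp only [Finset.mem_erase] at ha hb hr hs
  exact ⟨a, ha.2, b, hb.2, c, hcX, r, hr.2, c, hcY, s, hs.2, by grind⟩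

set_option maxHeartbeats 2000000 in
/-- For the complete graph on `{x₁, x₂, x₃, y₁, y₂, y₃}` minus exactly
the two edges `x₂y₂` and `x₃y₃`, with all lists of size at least 3, an `L`-coloring
exists iff every clique `Q` satisfies `|L(Q)| ≥ |Q|`; in particular it exists when
`|L(x₁) ∪ L(y₁)| ≥ 4`. -/
theorem list_colorable_iff_hall_x3y3
    {V : Type*} [DecidableEq V] (H : SimpleGraph V) (x1 x2 x3 y1 y2 y3 : V)
    (hnodup : [x1, x2, x3, y1, y2, y3].Nodup)
    (huniv : ∀ v : V, v = x1 ∨ v = x2 ∨ v = x3 ∨ v = y1 ∨ v = y2 ∨ v = y3)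
    (hadj : ∀ u v : V, H.Adj u v ↔
      u ≠ v ∧ ¬((u, v) ∈ ({(x2, y2), (y2, x2), (x3, y3), (y3, x3)} : Set (V × V))))
    (L : V → Finset ℕ) (hL : ∀ u : V, 3 ≤ (L u).card) :
    (ListColorable H L ↔
      ∀ Q : Finset V, H.IsClique (Q : Set V) → Q.card ≤ (Q.biUnion L).card) ∧
    (4 ≤ (L x1 ∪ L y1).card → ListColorable H L) := by
  have hnd := hnodup
  simp only [List.nodup_cons, List.mem_cons, List.not_mem_nil, not_or, or_false] at hnd
  have main : (∀ Q : Finset V, H.IsClique (Q : Set V) → Q.card ≤ (Q.biUnion L).card) →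
      ListColorable H L := by
    intro hall
    have fin : Col6 (L x1) (L y1) (L x2) (L x3) (L y2) (L y3) → ListColorable H L := by
      rintro ⟨a, ha, b, hb, p, hp, r, hr, q, hq, s, hs, h⟩
      refine ⟨fun v => if v = x1 then a else if v = y1 then b else if v = x2 then p else
        if v = x3 then r else if v = y2 then q else s, ?_, ?_⟩
      · intro v
        rcases huniv v with h | h | h | h | h | h <;> subst h <;> grind
      · intro u w huw
        rw [hadj] at huw
        simp only [Set.mem_insert_iff, Set.mem_singleton_iff, Prod.mk.injEq] at huw
        rcases huniv u with h | h | h | h | h | h <;>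
          rcases huniv w with h' | h' | h' | h' | h' | h' <;> rw [h, h'] at huw ⊢ <;> grind
    have four : ∀ u w : V, x1 ≠ u → x1 ≠ w → y1 ≠ u → y1 ≠ w → H.Adj u w →
        4 ≤ (L x1 ∪ L y1 ∪ L u ∪ L w).card := by
      intro u w h1 h2 h3 h4 huw
      have hcl : H.IsClique (({x1, y1, u, w} : Finset V) : Set V) := by
        intro s hs t ht hst
        simp only [Finset.coe_insert, Finset.coe_singleton, Set.mem_insert_iff,
          Set.mem_singleton_iff] at hs ht
        have hwu := huw.symm
        rcases hs with rfl | rfl | rfl | rfl <;> rcases ht with rfl | rfl | rfl | rfl <;>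
          first
          | exact absurd rfl hst
          | assumption
          | (rw [hadj]
             simp only [Set.mem_insert_iff, Set.mem_singleton_iff, Prod.mk.injEq]
             grind)
      have := hall _ hcl
      have hne := huw.ne
      have hc : ({x1, y1, u, w} : Finset V).card = 4 := by
        have hxy : x1 ≠ y1 := by grind
        rw [Finset.card_insert_of_notMem (by simp; tauto),
          Finset.card_insert_of_notMem (by simp; tauto), Finset.card_pair hne]
      rw [hc] at this
      simpa [Finset.biUnion_insert, ← Finset.union_assoc] using this
    have ad : ∀ u w : V, u ≠ w → ¬ (u = x2 ∧ w = y2) → ¬ (u = y2 ∧ w = x2) →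
        ¬ (u = x3 ∧ w = y3) → ¬ (u = y3 ∧ w = x3) → H.Adj u w := by
      intro u w h h1 h2 h3 h4
      rw [hadj]
      simp only [Set.mem_insert_iff, Set.mem_singleton_iff, Prod.mk.injEq]
      tauto
    have h22 := four x2 x3 (by grind) (by grind) (by grind) (by grind)
      (ad _ _ (by grind) (by grind) (by grind) (by grind) (by grind))
    have h23 := four x2 y3 (by grind) (by grind) (by grind) (by grind)
      (ad _ _ (by grind) (by grind) (by grind) (by grind) (by grind))
    have h32 := four y2 x3 (by grind) (by grind) (by grind) (by grind)
      (ad _ _ (by grind) (by grind) (by grind) (by grind) (by grind))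
    have h33 := four y2 y3 (by grind) (by grind) (by grind) (by grind)
      (ad _ _ (by grind) (by grind) (by grind) (by grind) (by grind))
    by_cases hc2 : ∃ c ∈ L x2, c ∈ L y2
    · obtain ⟨c, h1, h2⟩ := hc2
      exact fin (col_c (hL _) (hL _) (hL _) (hL _) h1 h2 h22 h23 h32 h33)
    by_cases hc3 : ∃ c ∈ L x3, c ∈ L y3
    · obtain ⟨c, h1, h2⟩ := hc3
      refine fin (Col6.swap23 (col_c (hL _) (hL _) (hL _) (hL _) h1 h2 ?_ ?_ ?_ ?_)) <;>
        rwa [Finset.union_right_comm]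
    -- both pairs have disjoint lists
    have six : ∀ Q : Finset V, Q.card ≤ 6 := by
      intro Q
      have : Q ⊆ [x1, x2, x3, y1, y2, y3].toFinset := by
        intro v _
        simpa using huniv v
      exact (Finset.card_le_card this).trans (List.toFinset_card_le _)
    have big : ∀ (Q : Finset V) (u w : V), u ∈ Q → w ∈ Q → (¬ ∃ c ∈ L u, c ∈ L w) →
        Q.card ≤ (Q.biUnion L).card := by
      intro Q u w hu hw hn
      have hdj : Disjoint (L u) (L w) := by
        rw [Finset.disjoint_left]; intro c h1 h2; exact hn ⟨c, h1, h2⟩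
      have h1 := Finset.card_le_card (Finset.union_subset
        (Finset.subset_biUnion_of_mem L hu) (Finset.subset_biUnion_of_mem L hw))
      rw [Finset.card_union_of_disjoint hdj] at h1
      have := six Q
      have := hL u
      have := hL w
      omega
    obtain ⟨f, hf, hm⟩ := (Finset.all_card_le_biUnion_card_iff_exists_injective L).1 (by
      intro Q
      by_cases e2 : x2 ∈ Q ∧ y2 ∈ Q
      · exact big Q _ _ e2.1 e2.2 hc2
      by_cases e3 : x3 ∈ Q ∧ y3 ∈ Q
      · exact big Q _ _ e3.1 e3.2 hc3
      refine hall Q ?_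
      intro s hs t ht hst
      have hs' : s ∈ Q := hs
      have ht' : t ∈ Q := ht
      apply ad s t hst <;> rintro ⟨h1, h2⟩ <;> rw [h1] at hs' <;> rw [h2] at ht'
      · exact e2 ⟨hs', ht'⟩
      · exact e2 ⟨ht', hs'⟩
      · exact e3 ⟨hs', ht'⟩
      · exact e3 ⟨ht', hs'⟩)
    exact ⟨f, hm, fun u w h => hf.ne h.ne⟩
  refine ⟨⟨?_, main⟩, ?_⟩
  · rintro ⟨c, hc, hp⟩ Q hQ
    have hinj : Set.InjOn c (Q : Set V) := by
      intro s hs t ht hst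
      by_contra hne
      exact hp (hQ hs ht hne) hst
    rw [← Finset.card_image_of_injOn hinj]
    apply Finset.card_le_card
    intro z hz
    obtain ⟨v, hv, rfl⟩ := Finset.mem_image.1 hz
    exact Finset.mem_biUnion.2 ⟨v, hv, hc v⟩
  · intro h4
    apply main
    intro Q hQ
    rcases Q.eq_empty_or_nonempty with rfl | ⟨v, hv⟩
    · simp
    by_cases h3 : Q.card ≤ 3
    · exact h3.trans ((hL v).trans (Finset.card_le_card (Finset.subset_biUnion_of_mem L hv)))
    have n2 : ¬ (x2 ∈ Q ∧ y2 ∈ Q) := by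
      rintro ⟨h1, h2⟩
      have := (hadj _ _).1 (hQ h1 h2 (by grind))
      simp at this
    have n3 : ¬ (x3 ∈ Q ∧ y3 ∈ Q) := by
      rintro ⟨h1, h2⟩
      have := (hadj _ _).1 (hQ h1 h2 (by grind))
      simp at this
    obtain ⟨u, hu⟩ : ∃ u, ∀ z ∈ Q, z = x2 ∨ z = y2 → z = u := by
      by_cases h : x2 ∈ Q
      · exact ⟨x2, by grind⟩
      · exact ⟨y2, by grind⟩
    obtain ⟨w, hw⟩ : ∃ w, ∀ z ∈ Q, z = x3 ∨ z = y3 → z = w := by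
      by_cases h : x3 ∈ Q
      · exact ⟨x3, by grind⟩
      · exact ⟨y3, by grind⟩
    have hsub : Q ⊆ {x1, y1, u, w} := by
      intro z hz
      have := huniv z
      have := hu z hz
      have := hw z hz
      simp only [Finset.mem_insert, Finset.mem_singleton]
      tauto
    have hle : ({x1, y1, u, w} : Finset V).card ≤ 4 := Finset.card_le_four
    have heq : Q = {x1, y1, u, w} := Finset.eq_of_subset_of_card_le hsub (by omega)
    have hx : x1 ∈ Q := by rw [heq]; simp
    have hy : y1 ∈ Q := by rw [heq]; simp
    have := Finset.card_le_card (Finset.union_subset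
      (Finset.subset_biUnion_of_mem L hx) (Finset.subset_biUnion_of_mem L hy))
    have := Finset.card_le_card hsub
    omega
end

section
/- Let H be a cobipartite graph with clique number ω(H) ≤ 4. Let x and y be two adjacent vertices of H such that N(x) \ {y} and N(y) \ {x} are cliques and V(H) = N(x) ∪ N(y). Let L be a list assignment on V(H) such that |L(x)| ≥ 2, |L(y)| ≥ 2, and |L(v)| ≥ 4 for every vertex v ∈ V(H) \ {x, y}. Then H admits an L-coloring. -/
open SimpleGraph

variable {V : Type*}

/-- Coefficient of the monomial with exponents `l` in the product of `X u - X v` over the edges. -/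
def edgeCoeff {n : ℕ} : List (Fin n × Fin n) → List ℕ → ℤ
  | [], l => if l.all (fun k => k == 0) then 1 else 0
  | e :: es, l =>
    (match l.getD e.1.val 0 with
      | 0 => 0
      | k + 1 => edgeCoeff es (l.set e.1.val k)) -
    (match l.getD e.2.val 0 with
      | 0 => 0
      | k + 1 => edgeCoeff es (l.set e.2.val k))

noncomputable def edgePoly {n : ℕ} (es : List (Fin n × Fin n)) : MvPolynomial (Fin n) ℤ :=
  (es.map (fun e => MvPolynomial.X e.1 - MvPolynomial.X e.2)).prod

theorem edgePoly_aux {n : ℕ} (p : MvPolynomial (Fin n) ℤ) (F : List ℕ → ℤ)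
    (ih : ∀ (m : Fin n →₀ ℕ) (l : List ℕ), l.length = n → (∀ i : Fin n, m i = l.getD i.val 0) →
      p.coeff m = F l)
    (m : Fin n →₀ ℕ) (l : List ℕ) (hl : l.length = n) (h : ∀ i : Fin n, m i = l.getD i.val 0)
    (u : Fin n) :
    (MvPolynomial.X u * p).coeff m =
      (match l.getD u.val 0 with
      | 0 => 0
      | k + 1 => F (l.set u.val k)) := by
  classical
  rw [MvPolynomial.coeff_X_mul']
  have hu := h u
  cases hk : l.getD u.val 0 with
  | zero =>
    rw [hk] at hu
    simp [hu]
  | succ k =>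
    rw [hk] at hu
    rw [if_pos (by simp [hu])]
    apply ih
    · simpa using hl
    · intro i
      by_cases hi : i = u
      · subst hi
        simp [hu, hl]
      · have h2 : (u : ℕ) ≠ i := fun h => hi (Fin.ext h.symm)
        have := h i
        simp only [List.getD_eq_getElem?_getD] at this ⊢
        rw [List.getElem?_set_ne h2]
        simp [Finsupp.single_apply, Ne.symm hi, this]

theorem edgePoly_coeff {n : ℕ} (es : List (Fin n × Fin n)) :
    ∀ (m : Fin n →₀ ℕ) (l : List ℕ), l.length = n → (∀ i : Fin n, m i = l.getD i.val 0) →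
      (edgePoly es).coeff m = edgeCoeff es l := by
  classical
  induction es with
  | nil =>
    intro m l hl h
    have : (l.all (fun k => k == 0) = true) ↔ 0 = m := by
      rw [List.all_eq_true]
      constructor
      · intro hh
        ext i
        rw [h i]
        have hi : i.val < l.length := by omega
        have := hh (l[i.val]) (List.getElem_mem hi)
        simp at this
        simp [hi, this]
      · intro hh k hk
        obtain ⟨i, hi, rfl⟩ := List.getElem_of_mem hk
        have := h ⟨i, by omega⟩
        rw [← hh] at this
        simp [hi] at this
        simp [← this]
    simp only [edgePoly, edgeCoeff, List.map_nil, List.prod_nil, MvPolynomial.coeff_one]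
    simp only [this]
  | cons e es ih =>
    intro m l hl h
    have : edgePoly (e :: es) = MvPolynomial.X e.1 * edgePoly es - MvPolynomial.X e.2 * edgePoly es := by
      simp [edgePoly, sub_mul]
    rw [this, MvPolynomial.coeff_sub, edgePoly_aux _ _ ih m l hl h, edgePoly_aux _ _ ih m l hl h]
    rfl

theorem edgePoly_totalDegree {n : ℕ} (es : List (Fin n × Fin n)) :
    (edgePoly es).totalDegree ≤ es.length := by
  induction es with
  | nil => simp [edgePoly]
  | cons e es ih =>
    have : edgePoly (e :: es) = (MvPolynomial.X e.1 - MvPolynomial.X e.2) * edgePoly es := by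
      simp [edgePoly]
    rw [this]
    refine (MvPolynomial.totalDegree_mul _ _).trans ?_
    have h1 : (MvPolynomial.X e.1 - MvPolynomial.X e.2 : MvPolynomial (Fin n) ℤ).totalDegree ≤ 1 := by
      refine (MvPolynomial.totalDegree_sub _ _).trans ?_
      simp
    simp only [List.length_cons]
    omega

/-- Alon–Tarsi for an explicit template. -/
theorem template_color {n : ℕ} (es : List (Fin n × Fin n)) (l : List ℕ) (hl : l.length = n)
    (hsum : es.length = ∑ i : Fin n, l.getD i.val 0) (hc : edgeCoeff es l ≠ 0)
    (L : Fin n → Finset ℕ) (hL : ∀ i, l.getD i.val 0 < (L i).card) :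
    ∃ c : Fin n → ℕ, (∀ i, c i ∈ L i) ∧ ∀ e ∈ es, c e.1 ≠ c e.2 := by
  classical
  let t : Fin n →₀ ℕ := Finsupp.equivFunOnFinite.symm (fun i => l.getD i.val 0)
  have ht : (edgePoly es).coeff t ≠ 0 := by
    rw [edgePoly_coeff es t l hl (fun i => rfl)]
    exact hc
  have hdeg : t.degree = es.length := by
    rw [hsum, Finsupp.degree_eq_sum]
    rfl
  have htd : (edgePoly es).totalDegree = t.degree := by
    apply le_antisymm
    · rw [hdeg]; exact edgePoly_totalDegree es
    · have := MvPolynomial.le_totalDegree (MvPolynomial.mem_support_iff.2 ht)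
      exact this
  obtain ⟨s, hs, hne⟩ := MvPolynomial.combinatorial_nullstellensatz_exists_eval_nonzero
    (edgePoly es) t ht htd (fun i => (L i).map Nat.castEmbedding)
    (fun i => by rw [Finset.card_map]; exact hL i)
  have : ∀ i, ∃ k ∈ L i, (k : ℤ) = s i := by
    intro i
    simpa using hs i
  choose c hc1 hc2 using this
  refine ⟨c, hc1, ?_⟩
  intro e he heq
  apply hne
  simp only [edgePoly, map_list_prod, List.map_map]
  apply List.prod_eq_zero
  rw [List.mem_map]
  refine ⟨e, he, ?_⟩
  simp [← hc2, heq]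

/-- Transfer from a template to a graph covered by it. -/
theorem transfer {V : Type*} (H : SimpleGraph V) (L : V → Finset ℕ) {n : ℕ}
    (es : List (Fin n × Fin n)) (l : List ℕ) (hl : l.length = n)
    (hsum : es.length = ∑ i : Fin n, l.getD i.val 0) (hc : edgeCoeff es l ≠ 0)
    (g : Fin n → Option V) (hg : ∀ v, ∃ i, g i = some v)
    (hL : ∀ i v, g i = some v → l.getD i.val 0 < (L v).card)
    (hadj : ∀ i j, (i, j) ∉ es → (j, i) ∉ es →
      ¬ ∃ u w, g i = some u ∧ g j = some w ∧ H.Adj u w) :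
    ListColorable H L := by
  classical
  obtain ⟨c, hc1, hc2⟩ := template_color es l hl hsum hc
    (fun i => match g i with
      | some v => L v
      | none => Finset.range (l.getD i.val 0 + 1)) (by
      intro i
      cases h : g i with
      | none => simp
      | some v => simpa using hL i v h)
  choose f hf using hg
  refine ⟨fun v => c (f v), ?_, ?_⟩
  · intro v
    have := hc1 (f v)
    simpa [hf v] using this
  · intro u w huw heq
    by_cases h1 : (f u, f w) ∈ es
    · exact hc2 _ h1 heq
    by_cases h2 : (f w, f u) ∈ es
    · exact hc2 _ h2 heq.symm
    exact hadj _ _ h1 h2 ⟨u, w, hf u, hf w, huw⟩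

def tpl0 : List (Fin 8 × Fin 8) :=
  [(0,1),(0,2),(0,3),(0,4),(1,5),(1,6),(1,7),(2,3),(2,4),(3,4),(5,6),(5,7),(6,7),
   (2,6),(2,7),(3,5),(3,7),(4,5),(4,6),(4,7)]

def tpl1 : List (Fin 7 × Fin 7) :=
  [(0,1),(0,2),(1,2),(0,3),(0,4),(1,5),(1,6),(2,3),(2,4),(2,5),(2,6),(3,4),(5,6),(3,6),(4,5),(4,6)]

def tpl2 : List (Fin 6 × Fin 6) :=
  [(0,1),(0,2),(0,3),(1,2),(1,3),(0,4),(1,5),(2,3),(4,5),(2,4),(3,4),(2,5),(3,5)]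

theorem tpl0_coeff : edgeCoeff tpl0 [1,1,3,3,3,3,3,3] ≠ 0 := by decide +kernel
theorem tpl1_coeff : edgeCoeff tpl1 [1,1,2,3,3,3,3] ≠ 0 := by decide +kernel
theorem tpl2_coeff : edgeCoeff tpl2 [1,1,2,3,3,3] ≠ 0 := by decide +kernel

theorem exists_enum {V : Type*} (A : Finset V) (k : ℕ) (h : A.card ≤ k) :
    ∃ a : Fin k → Option V, (∀ i v, a i = some v → v ∈ A) ∧ (∀ v ∈ A, ∃ i, a i = some v) ∧
      (∀ i j v, a i = some v → a j = some v → i = j) := by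
  classical
  obtain ⟨e⟩ : Nonempty (A ↪ Fin k) := by
    apply Function.Embedding.nonempty_of_card_le
    simpa using h
  refine ⟨fun i => if h : ∃ v : A, e v = i then some (h.choose : V) else none, ?_, ?_, ?_⟩
  · intro i v hv
    dsimp only at hv
    split at hv
    · rename_i hh
      have := hh.choose.2
      simp only [Option.some.injEq] at hv
      rwa [hv] at this
    · simp at hv
  · intro v hv
    refine ⟨e ⟨v, hv⟩, ?_⟩
    have hh : ∃ w : A, e w = e ⟨v, hv⟩ := ⟨_, rfl⟩
    have := e.injective hh.choose_spec
    simp only [dif_pos hh, this]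
  · intro i j v hi hj
    dsimp only at hi hj
    split at hi
    · split at hj
      · rename_i h1 h2
        simp only [Option.some.injEq] at hi hj
        rw [← h1.choose_spec, ← h2.choose_spec]
        congr 1
        exact Subtype.ext (hi.trans hj.symm)
      · simp at hj
    · simp at hi

theorem match2 (R : Fin 3 → Fin 3 → Bool)
    (h1 : ∀ i i', i ≠ i' → ∃ j, R i j = false ∨ R i' j = false)
    (h2 : ∀ j j', j ≠ j' → ∃ i, R i j = false ∨ R i j' = false) :
    ∃ i i' j j', i ≠ i' ∧ j ≠ j' ∧ R i j = false ∧ R i' j' = false := by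
  have h01 := h1 0 1 (by decide)
  have h02 := h1 0 2 (by decide)
  have h12 := h1 1 2 (by decide)
  have k01 := h2 0 1 (by decide)
  have k02 := h2 0 2 (by decide)
  have k12 := h2 1 2 (by decide)
  clear h1 h2
  by_contra hcon
  push Not at hcon
  obtain ⟨i, hi⟩ := h01
  grind

theorem third (i i' : Fin 3) (h : i ≠ i') : ∃ k : Fin 3, ∀ m, m = i ∨ m = i' ∨ m = k := by
  revert i i'; decide

def oAdj {V : Type*} (H : SimpleGraph V) (p q : Option V) : Prop :=
  ∃ u w, p = some u ∧ q = some w ∧ H.Adj u w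

theorem oAdj_irr {V : Type*} (H : SimpleGraph V) (p : Option V) : ¬ oAdj H p p := by
  rintro ⟨u, w, h1, h2, h⟩
  rw [h1] at h2
  cases h2
  exact H.irrefl h

theorem oAdj_symm {V : Type*} (H : SimpleGraph V) {p q : Option V} (h : ¬ oAdj H p q) :
    ¬ oAdj H q p := by
  rintro ⟨u, w, h1, h2, h3⟩
  exact h ⟨w, u, h2, h1, h3.symm⟩

/-- Let `H` be cobipartite with `ω(H) ≤ 4`, and let `x, y` be adjacent
vertices with `N(x) \ {y}` and `N(y) \ {x}` cliques and `V(H) = N(x) ∪ N(y)`.  If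
`|L(x)|, |L(y)| ≥ 2` and `|L(v)| ≥ 4` for all other `v`, then `H` is `L`-colorable. -/
theorem cobipartite_two_centers_list_colorable
    {V : Type*} [Fintype V] (H : SimpleGraph V)
    (hco : Cobipartite H) (homega : cliqueNumber H ≤ 4)
    (x y : V) (hxy : H.Adj x y)
    (hNx : H.IsClique (H.neighborSet x \ {y}))
    (hNy : H.IsClique (H.neighborSet y \ {x}))
    (hcover : H.neighborSet x ∪ H.neighborSet y = Set.univ)
    (L : V → Finset ℕ)
    (hLx : 2 ≤ (L x).card) (hLy : 2 ≤ (L y).card)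
    (hL : ∀ v : V, v ≠ x → v ≠ y → 4 ≤ (L v).card) :
    ListColorable H L := by
  classical
  have hclq : ∀ s : Finset V, H.IsClique (s : Set V) → s.card ≤ 4 := by
    intro s hs
    refine le_trans ?_ homega
    apply le_csSup
    · refine ⟨Fintype.card V, ?_⟩
      rintro n ⟨t, ht⟩
      rw [← ht.card_eq]
      exact Finset.card_le_univ t
    · exact ⟨s, ⟨hs, rfl⟩⟩
  have hK5 : ∀ a b c d e : V, H.Adj a b → H.Adj a c → H.Adj a d → H.Adj a e → H.Adj b c →
      H.Adj b d → H.Adj b e → H.Adj c d → H.Adj c e → H.Adj d e → False := by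
    intro a b c d e ab ac ad ae bc bd be cd ce de
    have h1 := hclq {a, b, c, d, e} (by
      simp [SimpleGraph.isClique_insert, *])
    have h2 : ({a, b, c, d, e} : Finset V).card = 5 := by
      simp [Finset.card_insert_of_notMem, ab.ne, ac.ne, ad.ne, ae.ne, bc.ne, bd.ne, be.ne, cd.ne,
        ce.ne, de.ne]
    omega
  have hne := hxy.ne
  have hX : ∀ u w, H.Adj x u → u ≠ y → H.Adj x w → w ≠ y → u ≠ w → H.Adj u w :=
    fun u w h1 h2 h3 h4 h5 => hNx ⟨h1, h2⟩ ⟨h3, h4⟩ h5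
  have hY : ∀ u w, H.Adj y u → u ≠ x → H.Adj y w → w ≠ x → u ≠ w → H.Adj u w :=
    fun u w h1 h2 h3 h4 h5 => hNy ⟨h1, h2⟩ ⟨h3, h4⟩ h5
  have hcov : ∀ v, H.Adj x v ∨ H.Adj y v := by
    intro v
    have : v ∈ H.neighborSet x ∪ H.neighborSet y := by rw [hcover]; trivial
    exact this
  let A : Finset V := Finset.univ.filter (fun v => H.Adj x v ∧ ¬ H.Adj y v ∧ v ≠ y)
  let B : Finset V := Finset.univ.filter (fun v => H.Adj y v ∧ ¬ H.Adj x v ∧ v ≠ x)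
  let Z : Finset V := Finset.univ.filter (fun v => H.Adj x v ∧ H.Adj y v)
  have mA : ∀ v, v ∈ A ↔ H.Adj x v ∧ ¬ H.Adj y v ∧ v ≠ y := by intro v; simp [A]
  have mB : ∀ v, v ∈ B ↔ H.Adj y v ∧ ¬ H.Adj x v ∧ v ≠ x := by intro v; simp [B]
  have mZ : ∀ v, v ∈ Z ↔ H.Adj x v ∧ H.Adj y v := by intro v; simp [Z]
  have hall : ∀ v, v = x ∨ v = y ∨ v ∈ A ∨ v ∈ B ∨ v ∈ Z := by
    intro v
    rw [mA, mB, mZ]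
    have := hcov v
    tauto
  have lA : ∀ v ∈ A, 3 < (L v).card := by
    intro v hv
    rw [mA] at hv
    exact hL v hv.1.ne' hv.2.2
  have lB : ∀ v ∈ B, 3 < (L v).card := by
    intro v hv
    rw [mB] at hv
    exact hL v hv.2.2 hv.1.ne'
  have lZ : ∀ v ∈ Z, 3 < (L v).card := by
    intro v hv
    rw [mZ] at hv
    exact hL v hv.1.ne' hv.2.ne'
  have cA : ∀ u ∈ A, ∀ w ∈ A, u ≠ w → H.Adj u w := by
    intro u hu w hw h
    rw [mA] at hu hw
    exact hX u w hu.1 hu.2.2 hw.1 hw.2.2 h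
  have cB : ∀ u ∈ B, ∀ w ∈ B, u ≠ w → H.Adj u w := by
    intro u hu w hw h
    rw [mB] at hu hw
    exact hY u w hu.1 hu.2.2 hw.1 hw.2.2 h
  have cAZ : ∀ u ∈ A, ∀ w ∈ Z, H.Adj u w := by
    intro u hu w hw
    rw [mA] at hu
    rw [mZ] at hw
    exact hX u w hu.1 hu.2.2 hw.1 hw.2.ne' (fun h => hu.2.1 (h ▸ hw.2))
  have cBZ : ∀ u ∈ B, ∀ w ∈ Z, H.Adj u w := by
    intro u hu w hw
    rw [mB] at hu
    rw [mZ] at hw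
    exact hY u w hu.1 hu.2.2 hw.2 hw.1.ne' (fun h => hu.2.1 (h ▸ hw.1))
  have cZ : ∀ u ∈ Z, ∀ w ∈ Z, u ≠ w → H.Adj u w := by
    intro u hu w hw h
    rw [mZ] at hu hw
    exact hX u w hu.1 hu.2.ne' hw.1 hw.2.ne' h
  have kZ : Z.card ≤ 2 := by
    have h1 := hclq (insert x (insert y Z)) (by
      rw [Finset.coe_insert, Finset.coe_insert, SimpleGraph.isClique_insert,
        SimpleGraph.isClique_insert]
      refine ⟨⟨fun u hu w hw h => cZ u hu w hw h, fun b hb _ => ((mZ b).1 hb).2⟩, ?_⟩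
      intro b hb _
      rcases hb with rfl | hb
      · exact hxy
      · exact ((mZ b).1 hb).1)
    rw [Finset.card_insert_of_notMem, Finset.card_insert_of_notMem] at h1
    · omega
    · simp [mZ]
    · simp [mZ, hne]
  have kAZ : A.card + Z.card ≤ 3 := by
    have h1 := hclq (insert x (A ∪ Z)) (by
      rw [Finset.coe_insert, SimpleGraph.isClique_insert]
      constructor
      · intro u hu w hw h
        simp only [Finset.coe_union, Set.mem_union, Finset.mem_coe] at hu hw
        rcases hu with hu | hu <;> rcases hw with hw | hw
        · exact cA u hu w hw h
        · exact cAZ u hu w hw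
        · exact (cAZ w hw u hu).symm
        · exact cZ u hu w hw h
      · intro b hb _
        simp only [Finset.coe_union, Set.mem_union, Finset.mem_coe, mA, mZ] at hb
        tauto)
    rw [Finset.card_insert_of_notMem, Finset.card_union_of_disjoint] at h1
    · omega
    · rw [Finset.disjoint_left]
      intro u hu hw
      rw [mA] at hu
      rw [mZ] at hw
      tauto
    · simp [mZ, mA]
  have kBZ : B.card + Z.card ≤ 3 := by
    have h1 := hclq (insert y (B ∪ Z)) (by
      rw [Finset.coe_insert, SimpleGraph.isClique_insert]
      constructor
      · intro u hu w hw h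
        simp only [Finset.coe_union, Set.mem_union, Finset.mem_coe] at hu hw
        rcases hu with hu | hu <;> rcases hw with hw | hw
        · exact cB u hu w hw h
        · exact cBZ u hu w hw
        · exact (cBZ w hw u hu).symm
        · exact cZ u hu w hw h
      · intro b hb _
        simp only [Finset.coe_union, Set.mem_union, Finset.mem_coe, mB, mZ] at hb
        tauto)
    rw [Finset.card_insert_of_notMem, Finset.card_union_of_disjoint] at h1
    · omega
    · rw [Finset.disjoint_left]
      intro u hu hw
      rw [mB] at hu
      rw [mZ] at hw
      tauto
    · simp [mZ, mB]
  have nxB : ∀ p : Option V, (∀ v, p = some v → v ∈ B) → ¬ oAdj H (some x) p := by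
    rintro p hp ⟨u, w, h1, h2, h3⟩
    cases h1
    exact ((mB w).1 (hp w h2)).2.1 h3
  have nyA : ∀ p : Option V, (∀ v, p = some v → v ∈ A) → ¬ oAdj H (some y) p := by
    rintro p hp ⟨u, w, h1, h2, h3⟩
    cases h1
    exact ((mA w).1 (hp w h2)).2.1 h3
  have hz : Z.card = 0 ∨ Z.card = 1 ∨ Z.card = 2 := by omega
  rcases hz with hz | hz | hz
  · -- no common neighbours
    obtain ⟨a, a1, a2, a3⟩ := exists_enum A 3 (by omega)
    obtain ⟨b, b1, b2, b3⟩ := exists_enum B 3 (by omega)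
    have hm := match2 (fun i j => decide (oAdj H (a i) (b j))) (by
      intro i i' hi
      by_contra hcon
      simp only [decide_eq_false_iff_not, not_exists, not_or, not_not] at hcon
      obtain ⟨u, w0, hu, hw0, e1⟩ := (hcon 0).1
      obtain ⟨u', w0', hu', hw0', e2⟩ := (hcon 0).2
      obtain ⟨v, w1, hv, hw1, e3⟩ := (hcon 1).1
      obtain ⟨v', w1', hv', hw1', e4⟩ := (hcon 1).2
      obtain ⟨t, w2, ht, hw2, e5⟩ := (hcon 2).1
      obtain ⟨t', w2', ht', hw2', e6⟩ := (hcon 2).2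
      have q1 := hu.symm.trans hv
      have q2 := hu'.symm.trans hv'
      have q3 := hu.symm.trans ht
      have q4 := hu'.symm.trans ht'
      have q5 := hw0.symm.trans hw0'
      have q6 := hw1.symm.trans hw1'
      have q7 := hw2.symm.trans hw2'
      simp only [Option.some.injEq] at q1 q2 q3 q4 q5 q6 q7
      subst q1 q2 q3 q4 q5 q6 q7
      refine hK5 u u' w0 w1 w2 (cA u (a1 _ _ hu) u' (a1 _ _ hu') ?_) e1 e3 e5 e2 e4 e6
        (cB _ (b1 _ _ hw0) _ (b1 _ _ hw1) ?_) (cB _ (b1 _ _ hw0) _ (b1 _ _ hw2) ?_)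
        (cB _ (b1 _ _ hw1) _ (b1 _ _ hw2) ?_)
      · rintro rfl; exact hi (a3 _ _ _ hu hu')
      · rintro rfl; exact absurd (b3 _ _ _ hw0 hw1) (by decide)
      · rintro rfl; exact absurd (b3 _ _ _ hw0 hw2) (by decide)
      · rintro rfl; exact absurd (b3 _ _ _ hw1 hw2) (by decide)) (by
      intro i i' hi
      by_contra hcon
      simp only [decide_eq_false_iff_not, not_exists, not_or, not_not] at hcon
      obtain ⟨w0, u, hw0, hu, e1⟩ := (hcon 0).1
      obtain ⟨w0', u', hw0', hu', e2⟩ := (hcon 0).2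
      obtain ⟨w1, v, hw1, hv, e3⟩ := (hcon 1).1
      obtain ⟨w1', v', hw1', hv', e4⟩ := (hcon 1).2
      obtain ⟨w2, t, hw2, ht, e5⟩ := (hcon 2).1
      obtain ⟨w2', t', hw2', ht', e6⟩ := (hcon 2).2
      have q1 := hu.symm.trans hv
      have q2 := hu'.symm.trans hv'
      have q3 := hu.symm.trans ht
      have q4 := hu'.symm.trans ht'
      have q5 := hw0.symm.trans hw0'
      have q6 := hw1.symm.trans hw1'
      have q7 := hw2.symm.trans hw2'
      simp only [Option.some.injEq] at q1 q2 q3 q4 q5 q6 q7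
      subst q1 q2 q3 q4 q5 q6 q7
      refine hK5 u u' w0 w1 w2 (cB u (b1 _ _ hu) u' (b1 _ _ hu') ?_) e1.symm e3.symm e5.symm
        e2.symm e4.symm e6.symm
        (cA _ (a1 _ _ hw0) _ (a1 _ _ hw1) ?_) (cA _ (a1 _ _ hw0) _ (a1 _ _ hw2) ?_)
        (cA _ (a1 _ _ hw1) _ (a1 _ _ hw2) ?_)
      · rintro rfl; exact hi (b3 _ _ _ hu hu')
      · rintro rfl; exact absurd (a3 _ _ _ hw0 hw1) (by decide)
      · rintro rfl; exact absurd (a3 _ _ _ hw0 hw2) (by decide)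
      · rintro rfl; exact absurd (a3 _ _ _ hw1 hw2) (by decide))
    obtain ⟨i, i', j, j', hi, hj, r1, r2⟩ := hm
    simp only [decide_eq_false_iff_not] at r1 r2
    obtain ⟨i'', hi3⟩ := third i i' hi
    obtain ⟨j'', hj3⟩ := third j j' hj
    have f1 := fun k => nxB (b k) (b1 k)
    have f2 := fun k => nyA (a k) (a1 k)
    have f3 := fun k => oAdj_symm H (f1 k)
    have f4 := fun k => oAdj_symm H (f2 k)
    have r3 := oAdj_symm H r1
    have r4 := oAdj_symm H r2
    refine transfer H L tpl0 [1,1,3,3,3,3,3,3] rfl (by decide) tpl0_coeff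
      ![some x, some y, a i, a i', a i'', b j, b j', b j''] ?_ ?_ ?_
    · intro v
      rcases hall v with rfl | rfl | hv | hv | hv
      · exact ⟨0, rfl⟩
      · exact ⟨1, rfl⟩
      · obtain ⟨k, hk⟩ := a2 v hv
        rcases hi3 k with rfl | rfl | rfl
        · exact ⟨2, hk⟩
        · exact ⟨3, hk⟩
        · exact ⟨4, hk⟩
      · obtain ⟨k, hk⟩ := b2 v hv
        rcases hj3 k with rfl | rfl | rfl
        · exact ⟨5, hk⟩
        · exact ⟨6, hk⟩
        · exact ⟨7, hk⟩
      · rw [Finset.card_eq_zero] at hz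
        rw [hz] at hv
        simp at hv
    · intro k v hv
      fin_cases k <;> first
        | exact lA v (a1 _ _ hv)
        | exact lB v (b1 _ _ hv)
        | (cases hv; exact hLx)
        | (cases hv; exact hLy)
    · intro k m h1 h2
      fin_cases k <;> fin_cases m <;> first
        | exact (h1 (by decide)).elim
        | exact (h2 (by decide)).elim
        | exact oAdj_irr H _
        | exact f1 _
        | exact f2 _
        | exact f3 _
        | exact f4 _
        | exact r1
        | exact r2
        | exact r3
        | exact r4
  · obtain ⟨z, hzz⟩ := Finset.card_eq_one.1 hz
    have hzm : z ∈ Z := by simp [hzz]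
    obtain ⟨a, a1, a2, a3⟩ := exists_enum A 2 (by omega)
    obtain ⟨b, b1, b2, b3⟩ := exists_enum B 2 (by omega)
    have hm : ∃ i j, ¬ oAdj H (a i) (b j) := by
      by_contra hcon
      push Not at hcon
      obtain ⟨u, w, hu, hw, e1⟩ := hcon 0 0
      obtain ⟨u', w', hu', hw', e2⟩ := hcon 1 1
      obtain ⟨v, t', hv, ht', e3⟩ := hcon 0 1
      obtain ⟨v', t, hv', ht, e4⟩ := hcon 1 0
      have q1 := hu.symm.trans hv
      have q2 := hu'.symm.trans hv'
      have q3 := hw.symm.trans ht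
      have q4 := hw'.symm.trans ht'
      simp only [Option.some.injEq] at q1 q2 q3 q4
      subst q1 q2 q3 q4
      refine hK5 u u' w w' z (cA u (a1 _ _ hu) u' (a1 _ _ hu') ?_) e1 e3
        (cAZ _ (a1 _ _ hu) _ hzm) e4 e2 (cAZ _ (a1 _ _ hu') _ hzm)
        (cB _ (b1 _ _ hw) _ (b1 _ _ hw') ?_) (cBZ _ (b1 _ _ hw) _ hzm)
        (cBZ _ (b1 _ _ hw') _ hzm)
      · rintro rfl; exact absurd (a3 _ _ _ hu hu') (by decide)
      · rintro rfl; exact absurd (b3 _ _ _ hw hw') (by decide)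
    obtain ⟨i, j, r1⟩ := hm
    have sec : ∀ i : Fin 2, ∃ k : Fin 2, ∀ m, m = i ∨ m = k := by decide
    obtain ⟨i', hi3⟩ := sec i
    obtain ⟨j', hj3⟩ := sec j
    have f1 := fun k => nxB (b k) (b1 k)
    have f2 := fun k => nyA (a k) (a1 k)
    have f3 := fun k => oAdj_symm H (f1 k)
    have f4 := fun k => oAdj_symm H (f2 k)
    have r3 := oAdj_symm H r1
    refine transfer H L tpl1 [1,1,2,3,3,3,3] rfl (by decide) tpl1_coeff
      ![some x, some y, some z, a i, a i', b j, b j'] ?_ ?_ ?_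
    · intro v
      rcases hall v with rfl | rfl | hv | hv | hv
      · exact ⟨0, rfl⟩
      · exact ⟨1, rfl⟩
      · obtain ⟨k, hk⟩ := a2 v hv
        rcases hi3 k with rfl | rfl
        · exact ⟨3, hk⟩
        · exact ⟨4, hk⟩
      · obtain ⟨k, hk⟩ := b2 v hv
        rcases hj3 k with rfl | rfl
        · exact ⟨5, hk⟩
        · exact ⟨6, hk⟩
      · rw [hzz, Finset.mem_singleton] at hv
        exact ⟨2, by rw [hv]; rfl⟩
    · intro k v hv
      fin_cases k <;> first
        | exact lA v (a1 _ _ hv)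
        | exact lB v (b1 _ _ hv)
        | (cases hv; exact hLx)
        | (cases hv; exact hLy)
        | (cases hv; exact (Nat.lt_succ_self 2).trans (lZ _ hzm))
    · intro k m h1 h2
      fin_cases k <;> fin_cases m <;> first
        | exact (h1 (by decide)).elim
        | exact (h2 (by decide)).elim
        | exact oAdj_irr H _
        | exact f1 _
        | exact f2 _
        | exact f3 _
        | exact f4 _
        | exact r1
        | exact r3
  · obtain ⟨z, z1, z2, z3⟩ := exists_enum Z 2 (by omega)
    obtain ⟨a, a1, a2, a3⟩ := exists_enum A 1 (by omega)
    obtain ⟨b, b1, b2, b3⟩ := exists_enum B 1 (by omega)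
    have f1 := fun k => nxB (b k) (b1 k)
    have f2 := fun k => nyA (a k) (a1 k)
    have f3 := fun k => oAdj_symm H (f1 k)
    have f4 := fun k => oAdj_symm H (f2 k)
    refine transfer H L tpl2 [1,1,2,3,3,3] rfl (by decide) tpl2_coeff
      ![some x, some y, z 0, z 1, a 0, b 0] ?_ ?_ ?_
    · intro v
      rcases hall v with rfl | rfl | hv | hv | hv
      · exact ⟨0, rfl⟩
      · exact ⟨1, rfl⟩
      · obtain ⟨k, hk⟩ := a2 v hv
        rw [Subsingleton.elim k 0] at hk
        exact ⟨4, hk⟩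
      · obtain ⟨k, hk⟩ := b2 v hv
        rw [Subsingleton.elim k 0] at hk
        exact ⟨5, hk⟩
      · obtain ⟨k, hk⟩ := z2 v hv
        fin_cases k
        · exact ⟨2, hk⟩
        · exact ⟨3, hk⟩
    · intro k v hv
      fin_cases k <;> first
        | exact lA v (a1 _ _ hv)
        | exact lB v (b1 _ _ hv)
        | exact lZ v (z1 _ _ hv)
        | exact (Nat.lt_succ_self 2).trans (lZ v (z1 _ _ hv))
        | (cases hv; exact hLx)
        | (cases hv; exact hLy)
    · intro k m h1 h2
      fin_cases k <;> fin_cases m <;> first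
        | exact (h1 (by decide)).elim
        | exact (h2 (by decide)).elim
        | exact oAdj_irr H _
        | exact f1 _
        | exact f2 _
        | exact f3 _
        | exact f4 _
end

section
/- Let H be a graph on six vertices x_1, x_2, x_3, y_1, y_2, y_3 in which every pair of distinct vertices is adjacent except exactly the five pairs {x_1, y_1}, {x_2, y_2}, {x_3, y_3}, {x_3, y_1}, {x_1, y_2}. Let L be a list assignment on V(H) such that |L(x_3)| = 2, |L(y_2)| = 2, and |L(w)| = 3 for every vertex w ∈ V(H) \ {x_3, y_2}. Then H admits an L-coloring. -/
open SimpleGraph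

variable {V : Type*}

theorem pk1 (s : Finset ℕ) (h : 2 ≤ s.card) (x : ℕ) : ∃ y ∈ s, y ≠ x := by
  obtain ⟨y, hy, h'⟩ := Finset.exists_mem_notMem_of_card_lt_card
    (s := {x}) (t := s) (by rw [Finset.card_singleton]; omega)
  exact ⟨y, hy, by simpa using h'⟩

theorem pk2 (s : Finset ℕ) (h : 3 ≤ s.card) (x z : ℕ) : ∃ y ∈ s, y ≠ x ∧ y ≠ z := by
  obtain ⟨y, hy, h'⟩ := Finset.exists_mem_notMem_of_card_lt_card
    (s := {x, z}) (t := s) (by have := Finset.card_le_two (a := x) (b := z); omega)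
  exact ⟨y, hy, by simpa using h'⟩

def PC (A B C D E F : Finset ℕ) : Prop :=
  ∃ a ∈ A, ∃ b ∈ B, ∃ c ∈ C, ∃ d ∈ D, ∃ e ∈ E, ∃ f ∈ F,
    a ≠ c ∧ a ≠ d ∧ a ≠ e ∧ a ≠ f ∧ b ≠ d ∧ b ≠ e ∧ b ≠ f ∧ c ≠ e ∧ c ≠ f ∧ d ≠ f

theorem PC.symm {A B C D E F : Finset ℕ} (h : PC A B C D E F) : PC F E D C B A := by
  obtain ⟨a, ha, b, hb, c, hc, d, hd, e, he, f, hf, h⟩ := h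
  exact ⟨f, hf, e, he, d, hd, c, hc, b, hb, a, ha, by
    simp only [ne_eq, eq_comm] at h ⊢; tauto⟩

theorem pc_ab {A B C D E F : Finset ℕ} (hC : C.card = 3) (hD : D.card = 3)
    (hE : E.card = 2) (hF : F.card = 3) (t : ℕ) (hA : t ∈ A) (hB : t ∈ B) :
    PC A B C D E F := by
  obtain ⟨e, he, h1⟩ := pk1 E (by omega) t
  obtain ⟨c, hc, h2, h3⟩ := pk2 C (by omega) t e
  obtain ⟨f, hf, h4, h5⟩ := pk2 F (by omega) t c
  obtain ⟨d, hd, h6, h7⟩ := pk2 D (by omega) t f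
  exact ⟨t, hA, t, hB, c, hc, d, hd, e, he, f, hf, by grind⟩

theorem pc_bc {A B C D E F : Finset ℕ} (hA : A.card = 3) (hD : D.card = 3)
    (hE : E.card = 2) (hF : F.card = 3) (hAB : ∀ t ∈ A, t ∉ B)
    (hCD : ∀ t ∈ C, t ∉ D) (hEF : ∀ t ∈ E, t ∉ F) (t : ℕ) (hB : t ∈ B) (hC : t ∈ C) :
    PC A B C D E F := by
  by_cases ht : t ∈ E
  · obtain ⟨e, he, h1⟩ := pk1 E (by omega) t
    obtain ⟨a, ha, h2⟩ := pk1 A (by omega) e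
    obtain ⟨d, hd, h3⟩ := pk1 D (by omega) a
    obtain ⟨f, hf, h4, h5⟩ := pk2 F (by omega) a d
    exact ⟨a, ha, t, hB, t, hC, d, hd, e, he, f, hf, by grind⟩
  · obtain ⟨f, hf, h1⟩ := pk1 F (by omega) t
    obtain ⟨a, ha, h2⟩ := pk1 A (by omega) f
    obtain ⟨d, hd, h3, h4⟩ := pk2 D (by omega) a f
    obtain ⟨e, he, h5⟩ := pk1 E (by omega) a
    exact ⟨a, ha, t, hB, t, hC, d, hd, e, he, f, hf, by grind⟩

/-- `t` common to `B`, `C`, `D`, not in `E`. -/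
theorem pc_cd1 {A B C D E F : Finset ℕ} (hA : A.card = 3) (hB : B.card = 2)
    (hE : E.card = 2) (hF : F.card = 3) (hAB : ∀ t ∈ A, t ∉ B)
    (hEF : ∀ t ∈ E, t ∉ F) (t : ℕ) (hC : t ∈ C) (hD : t ∈ D) (htB : t ∈ B) (htE : t ∉ E) :
    PC A B C D E F := by
  obtain ⟨b, hb, h1⟩ := pk1 B (by omega) t
  by_cases hbE : b ∈ E
  · obtain ⟨e, he, h2⟩ := pk1 E (by omega) b
    obtain ⟨f, hf, h3⟩ := pk1 F (by omega) t
    obtain ⟨a, ha, h4, h5⟩ := pk2 A (by omega) e f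
    exact ⟨a, ha, b, hb, t, hC, t, hD, e, he, f, hf, by grind⟩
  · obtain ⟨f, hf, h3, h6⟩ := pk2 F (by omega) t b
    obtain ⟨e, he⟩ : E.Nonempty := Finset.card_pos.1 (by omega)
    obtain ⟨a, ha, h4, h5⟩ := pk2 A (by omega) e f
    exact ⟨a, ha, b, hb, t, hC, t, hD, e, he, f, hf, by grind⟩

theorem pc_cd2 {A B C D E F : Finset ℕ} (hA : A.card = 3) (hB : B.card = 2)
    (hE : E.card = 2) (hF : F.card = 3) (hAB : ∀ t ∈ A, t ∉ B)
    (hEF : ∀ t ∈ E, t ∉ F) (t : ℕ) (hC : t ∈ C) (hD : t ∈ D) (htB : t ∉ B) (htE : t ∉ E) :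
    PC A B C D E F := by
  by_cases h : ∃ b ∈ B, b ∉ F
  · obtain ⟨b, hb, h1⟩ := h
    obtain ⟨e, he, h2⟩ := pk1 E (by omega) b
    obtain ⟨a, ha, h3, h4⟩ := pk2 A (by omega) t e
    obtain ⟨f, hf, h5, h6⟩ := pk2 F (by omega) t a
    exact ⟨a, ha, b, hb, t, hC, t, hD, e, he, f, hf, by grind⟩
  · push Not at h
    obtain ⟨e, he⟩ : E.Nonempty := Finset.card_pos.1 (by omega)
    obtain ⟨a, ha, h3, h4⟩ := pk2 A (by omega) t e
    obtain ⟨f, hf, h5, h6⟩ := pk2 F (by omega) t a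
    obtain ⟨b, hb, h7⟩ := pk1 B (by omega) f
    exact ⟨a, ha, b, hb, t, hC, t, hD, e, he, f, hf, by grind⟩

theorem pc_cd {A B C D E F : Finset ℕ} (hA : A.card = 3) (hB : B.card = 2)
    (hDc : D.card = 3)
    (hE : E.card = 2) (hF : F.card = 3) (hAB : ∀ t ∈ A, t ∉ B)
    (hEF : ∀ t ∈ E, t ∉ F) (t : ℕ) (hC : t ∈ C) (hD : t ∈ D) :
    PC A B C D E F := by
  by_cases htB : t ∈ B
  · by_cases htE : t ∈ E
    · obtain ⟨b, hb, h1⟩ := pk1 B (by omega) t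
      obtain ⟨e, he, h2⟩ := pk1 E (by omega) t
      by_cases hbe : b = e
      · obtain ⟨d, hd, h3⟩ := pk1 D (by omega) t
        obtain ⟨a, ha, h4⟩ := pk1 A (by omega) d
        obtain ⟨f, hf, h5, h6⟩ := pk2 F (by omega) a d
        exact ⟨a, ha, t, htB, t, hC, d, hd, e, he, f, hf, by grind⟩
      · obtain ⟨f, hf, h3⟩ := pk1 F (by omega) b
        obtain ⟨a, ha, h4, h5⟩ := pk2 A (by omega) e f
        exact ⟨a, ha, b, hb, t, hC, t, hD, e, he, f, hf, by grind⟩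
    · exact pc_cd1 hA hB hE hF hAB hEF t hC hD htB htE
  · by_cases htE : t ∈ E
    · exact (pc_cd1 hF hE hB hA (fun t h h' => hEF t h' h) (fun t h h' => hAB t h' h)
        t hD hC htE htB).symm
    · exact pc_cd2 hA hB hE hF hAB hEF t hC hD htB htE

theorem pc_disj {A B C D E F : Finset ℕ} (hA : A.card = 3) (hB : B.card = 2)
    (hC : C.card = 3) (hD : D.card = 3) (hE : E.card = 2) (hF : F.card = 3)
    (hAB : Disjoint A B) (hBC : Disjoint B C) (hCD : Disjoint C D)
    (hDE : Disjoint D E) (hEF : Disjoint E F) : PC A B C D E F := by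
  have key : ∃ f : Fin 6 → ℕ, Function.Injective f ∧ ∀ i, f i ∈ (![A, B, C, D, E, F] : Fin 6 → Finset ℕ) i := by
    rw [← Finset.all_card_le_biUnion_card_iff_exists_injective]
    intro s
    have sub : ∀ i ∈ s, (![A, B, C, D, E, F] : Fin 6 → Finset ℕ) i ⊆
        s.biUnion ![A, B, C, D, E, F] := fun i hi => Finset.subset_biUnion_of_mem _ hi
    generalize s.biUnion ![A, B, C, D, E, F] = U at sub
    have one : ∀ i ∈ s, ((![A, B, C, D, E, F] : Fin 6 → Finset ℕ) i).card ≤ U.card :=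
      fun i hi => Finset.card_le_card (sub i hi)
    have two : ∀ i ∈ s, ∀ j ∈ s, Disjoint ((![A, B, C, D, E, F] : Fin 6 → Finset ℕ) i)
        ((![A, B, C, D, E, F] : Fin 6 → Finset ℕ) j) →
        ((![A, B, C, D, E, F] : Fin 6 → Finset ℕ) i).card +
        ((![A, B, C, D, E, F] : Fin 6 → Finset ℕ) j).card ≤ U.card := by
      intro i hi j hj h
      rw [← Finset.card_union_of_disjoint h]
      exact Finset.card_le_card (Finset.union_subset (sub i hi) (sub j hj))
    have a0 := one 0
    have a1 := one 1
    have a2 := one 2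
    have a3 := one 3
    have a4 := one 4
    have a5 := one 5
    have b0 := fun h k => two 0 h 1 k hAB
    have b1 := fun h k => two 1 h 2 k hBC
    have b2 := fun h k => two 2 h 3 k hCD
    have b3 := fun h k => two 3 h 4 k hDE
    have b4 := fun h k => two 4 h 5 k hEF
    have hs : s.card = ∑ i : Fin 6, if i ∈ s then 1 else 0 := by simp
    rw [Fin.sum_univ_six] at hs
    clear sub one two
    simp [hA, hB, hC, hD, hE, hF] at a0 a1 a2 a3 a4 a5 b0 b1 b2 b3 b4
    by_cases h0 : 0 ∈ s <;> by_cases h1 : 1 ∈ s <;> by_cases h2 : 2 ∈ s <;>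
    by_cases h3 : 3 ∈ s <;> by_cases h4 : 4 ∈ s <;> by_cases h5 : 5 ∈ s <;>
    simp only [h0, h1, h2, h3, h4, h5, if_true, if_false, true_imp_iff, false_imp_iff] at * <;> omega
  obtain ⟨f, hf, hm⟩ := key
  refine ⟨f 0, hm 0, f 1, hm 1, f 2, hm 2, f 3, hm 3, f 4, hm 4, f 5, hm 5, ?_⟩
  simp [hf.ne_iff]

theorem pc_all {A B C D E F : Finset ℕ} (hA : A.card = 3) (hB : B.card = 2)
    (hC : C.card = 3) (hD : D.card = 3) (hE : E.card = 2) (hF : F.card = 3) :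
    PC A B C D E F := by
  by_cases hAB : Disjoint A B
  swap
  · obtain ⟨t, h, h'⟩ := Finset.not_disjoint_iff.1 hAB
    exact pc_ab hC hD hE hF t h h'
  by_cases hEF : Disjoint E F
  swap
  · obtain ⟨t, h, h'⟩ := Finset.not_disjoint_iff.1 hEF
    exact (pc_ab hD hC hB hA t h' h).symm
  have hAB' : ∀ t ∈ A, t ∉ B := fun t h h' => Finset.disjoint_left.1 hAB h h'
  have hEF' : ∀ t ∈ E, t ∉ F := fun t h h' => Finset.disjoint_left.1 hEF h h'
  by_cases hCD : Disjoint C D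
  swap
  · obtain ⟨t, h, h'⟩ := Finset.not_disjoint_iff.1 hCD
    exact pc_cd hA hB hD hE hF hAB' hEF' t h h'
  have hCD' : ∀ t ∈ C, t ∉ D := fun t h h' => Finset.disjoint_left.1 hCD h h'
  by_cases hBC : Disjoint B C
  swap
  · obtain ⟨t, h, h'⟩ := Finset.not_disjoint_iff.1 hBC
    exact pc_bc hA hD hE hF hAB' hCD' hEF' t h h'
  by_cases hDE : Disjoint D E
  swap
  · obtain ⟨t, h, h'⟩ := Finset.not_disjoint_iff.1 hDE
    exact (pc_bc hF hC hB hA (fun t h h' => hEF' t h' h) (fun t h h' => hCD' t h' h)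
      (fun t h h' => hAB' t h' h) t h' h).symm
  exact pc_disj hA hB hC hD hE hF hAB hBC hCD hDE hEF

/-- For the complete graph on `{x₁, x₂, x₃, y₁, y₂, y₃}` minus exactly
the five edges `x₁y₁, x₂y₂, x₃y₃, x₃y₁, x₁y₂`, with `|L(x₃)| = |L(y₂)| = 2` and all
other lists of size 3, `H` is `L`-colorable. -/
theorem list_colorable_c3elem
    {V : Type*} (H : SimpleGraph V) (x1 x2 x3 y1 y2 y3 : V)
    (hnodup : [x1, x2, x3, y1, y2, y3].Nodup)
    (huniv : ∀ v : V, v = x1 ∨ v = x2 ∨ v = x3 ∨ v = y1 ∨ v = y2 ∨ v = y3)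
    (hadj : ∀ u v : V, H.Adj u v ↔
      u ≠ v ∧ ¬((u, v) ∈ ({(x1, y1), (y1, x1), (x2, y2), (y2, x2), (x3, y3), (y3, x3),
        (x3, y1), (y1, x3), (x1, y2), (y2, x1)} : Set (V × V))))
    (L : V → Finset ℕ)
    (hLx3 : (L x3).card = 2) (hLy2 : (L y2).card = 2)
    (hL : ∀ w : V, w ≠ x3 → w ≠ y2 → (L w).card = 3) :
    ListColorable H L := by
  classical
  have n := hnodup
  simp only [List.nodup_cons, List.mem_cons, List.not_mem_nil, or_false, not_or,
    not_false_eq_true, List.nodup_nil, and_true] at n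
  obtain ⟨⟨n12, n13, n14, n15, n16⟩, ⟨n23, n24, n25, n26⟩, ⟨n34, n35, n36⟩, ⟨n45, n46⟩, n56⟩ := n
  obtain ⟨a, ha, b, hb, c, hc, d, hd, e, he, f, hf, h⟩ :=
    pc_all (hL y3 (Ne.symm n36) (Ne.symm n56)) hLx3 (hL y1 (Ne.symm n34) n45)
      (hL x1 n13 n15) hLy2 (hL x2 n23 n25)
  refine ⟨fun v => if v = y3 then a else if v = x3 then b else if v = y1 then c else
    if v = x1 then d else if v = y2 then e else f, ?_, ?_⟩
  · intro v
    rcases huniv v with rfl | rfl | rfl | rfl | rfl | rfl <;> clear huniv hadj hnodup hL <;> grind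
  · intro u w huw
    rw [hadj] at huw
    obtain ⟨h1, h2⟩ := huw
    simp only [Set.mem_insert_iff, Set.mem_singleton_iff, Prod.mk.injEq, not_or] at h2
    clear hadj hL hnodup
    rcases huniv u with hu | hu | hu | hu | hu | hu <;>
      rcases huniv w with hw | hw | hw | hw | hw | hw <;> subst hu <;> subst hw <;> grind
end

section
/- Let H be a cobipartite graph with clique number ω(H) ≤ 4 whose vertex set is partitioned into two cliques X and Y, where X = {x_1, x_2, x_3} and x_1 is adjacent to every vertex of Y. Let L be a list assignment on V(H) such that |L(x_1)| ≥ 3, |L(x_2)| ≥ 2, |L(x_3)| ≥ 2, and |L(y)| ≥ 4 for every y ∈ Y. Then H admits an L-coloring. -/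
open SimpleGraph

variable {V : Type*}

theorem core_greedy (A1 A3 B1 B2 : Finset ℕ) (c : ℕ) (h1 : 3 ≤ A1.card) (h3 : 2 ≤ A3.card)
    (k1 : 4 ≤ B1.card) (k2 : 4 ≤ B2.card) :
    ∃ a1 ∈ A1, ∃ a3 ∈ A3, ∃ b1 ∈ B1, ∃ b2 ∈ B2, c ≠ a1 ∧ c ≠ a3 ∧ c ≠ b1 ∧ c ≠ b2 ∧
      a1 ≠ a3 ∧ a1 ≠ b1 ∧ a1 ≠ b2 ∧ a3 ≠ b2 ∧ b1 ≠ b2 := by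
  have key : ∀ (S T : Finset ℕ), T.card < S.card → ∃ x ∈ S, x ∉ T := fun S T h =>
    Finset.exists_mem_notMem_of_card_lt_card h
  obtain ⟨a3, m3, n3⟩ := key A3 {c} (by simp; omega)
  obtain ⟨a1, m1, n1⟩ := key A1 {c, a3} (by have := Finset.card_le_two (a := c) (b := a3); omega)
  obtain ⟨b2, p2, q2⟩ := key B2 {c, a3, a1}
    (by have := Finset.card_le_three (a := c) (b := a3) (c := a1); omega)
  obtain ⟨b1, p1, q1⟩ := key B1 {c, a1, b2}
    (by have := Finset.card_le_three (a := c) (b := a1) (c := b2); omega)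
  simp only [Finset.mem_insert, Finset.mem_singleton, not_or] at n3 n1 q2 q1
  refine ⟨a1, m1, a3, m3, b1, p1, b2, p2, ?_⟩
  grind

theorem core_sets : ∀ s : Finset (Fin 6), (1 ∈ s ∧ 5 ∈ s) ∨ (2 ∈ s ∧ 3 ∈ s) ∨
    (s.card ≤ 4 ∧ (3 ∈ s ∨ 4 ∈ s ∨ 5 ∈ s)) ∨ (s.card ≤ 3 ∧ 0 ∈ s) ∨
    (s.card ≤ 2 ∧ (1 ∈ s ∨ 2 ∈ s)) ∨ s.card = 0 := by decide

theorem core_lists (A1 A2 A3 : Finset ℕ) (B : Fin 3 → Finset ℕ) (h1 : 3 ≤ A1.card)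
    (h2 : 2 ≤ A2.card) (h3 : 2 ≤ A3.card) (hB : ∀ i, 4 ≤ (B i).card) :
    ∃ a1 ∈ A1, ∃ a2 ∈ A2, ∃ a3 ∈ A3, ∃ b : Fin 3 → ℕ, (∀ i, b i ∈ B i) ∧
      a1 ≠ a2 ∧ a1 ≠ a3 ∧ a2 ≠ a3 ∧ Function.Injective b ∧ (∀ i, a1 ≠ b i) ∧
      (∀ i, i ≠ 2 → a2 ≠ b i) ∧ (∀ i, i ≠ 0 → a3 ≠ b i) := by
  by_cases d2 : Disjoint A2 (B 2)
  · by_cases d3 : Disjoint A3 (B 0)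
    · have hall := (Finset.all_card_le_biUnion_card_iff_exists_injective
        (![A1, A2, A3, B 0, B 1, B 2] : Fin 6 → Finset ℕ)).1 (by
        intro s
        have sub : ∀ i ∈ s, (![A1, A2, A3, B 0, B 1, B 2] : Fin 6 → Finset ℕ) i ⊆
            s.biUnion ![A1, A2, A3, B 0, B 1, B 2] :=
          fun i hi => Finset.subset_biUnion_of_mem _ hi
        have le : ∀ i ∈ s, ((![A1, A2, A3, B 0, B 1, B 2] : Fin 6 → Finset ℕ) i).card ≤
            (s.biUnion ![A1, A2, A3, B 0, B 1, B 2]).card :=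
          fun i hi => Finset.card_le_card (sub i hi)
        have s6 : s.card ≤ 6 := by simpa using Finset.card_le_univ s
        have k0 := hB 0
        have k1 := hB 1
        have k2 := hB 2
        rcases core_sets s with ⟨u, v⟩ | ⟨u, v⟩ | ⟨c, u | u | u⟩ | ⟨c, u⟩ | ⟨c, u | u⟩ | c
        · have := Finset.card_le_card (Finset.union_subset (sub _ u) (sub _ v))
          have e : (A2 ∪ B 2).card = _ := Finset.card_union_of_disjoint d2
          change (A2 ∪ B 2).card ≤ _ at this
          omega
        · have := Finset.card_le_card (Finset.union_subset (sub _ u) (sub _ v))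
          have e : (A3 ∪ B 0).card = _ := Finset.card_union_of_disjoint d3
          change (A3 ∪ B 0).card ≤ _ at this
          omega
        · have := le _ u
          change (B 0).card ≤ _ at this
          omega
        · have := le _ u
          change (B 1).card ≤ _ at this
          omega
        · have := le _ u
          change (B 2).card ≤ _ at this
          omega
        · have := le _ u
          change A1.card ≤ _ at this
          omega
        · have := le _ u
          change A2.card ≤ _ at this
          omega
        · have := le _ u
          change A3.card ≤ _ at this
          omega
        · omega)
      obtain ⟨f, inj, hf⟩ := hall
      refine ⟨f 0, hf 0, f 1, hf 1, f 2, hf 2, fun i => f (Fin.natAdd 3 i), ?_, ?_⟩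
      · intro i
        fin_cases i
        · exact hf 3
        · exact hf 4
        · exact hf 5
      · refine ⟨inj.ne (by decide), inj.ne (by decide), inj.ne (by decide), ?_, ?_, ?_, ?_⟩
        · intro i j h
          have := congrArg Fin.val (inj h)
          simp only [Fin.val_natAdd] at this
          omega
        · intro i
          apply inj.ne
          revert i
          decide
        · intro i _
          apply inj.ne
          revert i
          decide
        · intro i _
          apply inj.ne
          revert i
          decide
    · obtain ⟨c, hc, hc'⟩ := Finset.not_disjoint_iff.1 d3
      obtain ⟨a1, m1, a2, m2, b2, p2, b1, p1, hh⟩ :=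
        core_greedy A1 A2 (B 2) (B 1) c h1 h2 (hB 2) (hB 1)
      refine ⟨a1, m1, a2, m2, c, hc, ![c, b1, b2], ?_, ?_⟩
      · intro i
        fin_cases i <;> assumption
      · simp only [Function.Injective, Fin.forall_fin_succ]
        simp
        grind
  · obtain ⟨c, hc, hc'⟩ := Finset.not_disjoint_iff.1 d2
    obtain ⟨a1, m1, a3, m3, b0, p0, b1, p1, hh⟩ :=
      core_greedy A1 A3 (B 0) (B 1) c h1 h3 (hB 0) (hB 1)
    refine ⟨a1, m1, c, hc, a3, m3, ![b0, b1, c], ?_, ?_⟩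
    · intro i
      fin_cases i <;> assumption
    · simp only [Function.Injective, Fin.forall_fin_succ]
      simp
      grind

theorem three_labels {V : Type*} (Y : Finset V) (hc : Y.card ≤ 3) (P Q : V → Prop)
    (hP : Y.card = 3 → ∃ y ∈ Y, ¬ P y) (hQ : Y.card = 3 → ∃ y ∈ Y, ¬ Q y)
    (hPQ : ∀ y ∈ Y, ∀ z ∈ Y, P y → Q y → P z → Q z → y = z) :
    ∃ f : V → Fin 3, (∀ y ∈ Y, ∀ z ∈ Y, f y = f z → y = z) ∧
      (∀ y ∈ Y, P y → f y ≠ 2) ∧ (∀ y ∈ Y, Q y → f y ≠ 0) := by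
  classical
  by_cases h3 : Y.card = 3
  · replace hP := hP h3
    replace hQ := hQ h3
    have : ∃ u ∈ Y, ∃ w ∈ Y, u ≠ w ∧ ¬ P u ∧ ¬ Q w := by
      obtain ⟨p, q, r, hpq, hpr, hqr, rfl⟩ := Finset.card_eq_three.1 h3
      have hp := hPQ p (by simp) q (by simp)
      have hq := hPQ p (by simp) r (by simp)
      have hr := hPQ q (by simp) r (by simp)
      clear hPQ h3 hc
      simp only [Finset.mem_insert, Finset.mem_singleton, exists_eq_or_imp, exists_eq_left] at *
      have := hpq.symm
      have := hpr.symm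
      have := hqr.symm
      by_cases P p <;> by_cases P q <;> by_cases P r <;> by_cases Q p <;> by_cases Q q <;>
        by_cases Q r <;> simp_all
    obtain ⟨u, hu, w, hw, huw, hPu, hQw⟩ := this
    refine ⟨fun y => if y = u then 2 else if y = w then 0 else 1, ?_, ?_, ?_⟩
    · obtain ⟨p, q, r, hpq, hpr, hqr, rfl⟩ := Finset.card_eq_three.1 h3
      simp only [Finset.mem_insert, Finset.mem_singleton] at *
      grind
    · grind
    · grind
  · by_cases h2 : ∃ u ∈ Y, ∃ w ∈ Y, u ≠ w
    · have : ∃ u ∈ Y, ∃ w ∈ Y, u ≠ w ∧ (¬ P u ∨ ¬ Q u) := by grind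
      obtain ⟨u, hu, w, hw, huw, hh⟩ := this
      have hY : ∀ y ∈ Y, y = u ∨ y = w := by
        intro y hy
        by_contra hne
        have : ({u, w, y} : Finset V) ⊆ Y := by
          intro z hz
          simp at hz
          grind
        have := Finset.card_le_card this
        rw [Finset.card_eq_three.2 ⟨u, w, y, huw, by grind, by grind, rfl⟩] at this
        omega
      rcases hh with hh | hh
      · exact ⟨fun y => if y = u then 2 else 1, by grind, by grind, by grind⟩
      · exact ⟨fun y => if y = u then 0 else 1, by grind, by grind, by grind⟩
    · exact ⟨fun _ => 1, by grind, by grind, by grind⟩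

/-- Let `H` be cobipartite with `ω(H) ≤ 4`, with vertex set
partitioned into cliques `X = {x₁, x₂, x₃}` and `Y`, where `x₁` is complete to `Y`.
If `|L(x₁)| ≥ 3`, `|L(x₂)|, |L(x₃)| ≥ 2` and `|L(y)| ≥ 4` on `Y`, then `H` is
`L`-colorable. -/
theorem cobipartite_x1_complete_list_colorable
    {V : Type*} [Fintype V] (H : SimpleGraph V) (homega : cliqueNumber H ≤ 4)
    (X Y : Set V) (hdisj : Disjoint X Y) (hcover : X ∪ Y = Set.univ)
    (hX : H.IsClique X) (hY : H.IsClique Y)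
    (x1 x2 x3 : V) (h12 : x1 ≠ x2) (h13 : x1 ≠ x3) (h23 : x2 ≠ x3)
    (hXeq : X = {x1, x2, x3})
    (hx1 : ∀ y ∈ Y, H.Adj x1 y)
    (L : V → Finset ℕ)
    (hL1 : 3 ≤ (L x1).card) (hL2 : 2 ≤ (L x2).card) (hL3 : 2 ≤ (L x3).card)
    (hLY : ∀ y ∈ Y, 4 ≤ (L y).card) :
    ListColorable H L := by
  classical
  have hcl : ∀ s : Finset V, H.IsClique (s : Set V) → s.card ≤ 4 := by
    intro s hs
    refine le_trans (le_csSup ?_ ?_) homega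
    · refine ⟨Fintype.card V, ?_⟩
      rintro n ⟨t, ht⟩
      rw [← ht.card_eq]
      exact Finset.card_le_univ t
    · exact ⟨s, hs, rfl⟩
  have mX : ∀ v, v ∈ X ↔ v = x1 ∨ v = x2 ∨ v = x3 := by
    intro v
    rw [hXeq]
    simp
  have nX : ∀ v, v ∈ X → v ∉ Y := fun v hv => Set.disjoint_left.1 hdisj hv
  have cov : ∀ v, v ∈ X ∨ v ∈ Y := fun v => by
    have : v ∈ X ∪ Y := hcover ▸ Set.mem_univ v
    exact this
  have a12 : H.Adj x1 x2 := hX (by simp [mX]) (by simp [mX]) h12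
  have a13 : H.Adj x1 x3 := hX (by simp [mX]) (by simp [mX]) h13
  have a23 : H.Adj x2 x3 := hX (by simp [mX]) (by simp [mX]) h23
  have n1 : x1 ∉ Y := nX _ (by simp [mX])
  have n2 : x2 ∉ Y := nX _ (by simp [mX])
  have n3 : x3 ∉ Y := nX _ (by simp [mX])
  have c1 : H.IsClique (insert x1 Y) := hY.insert (fun b hb _ => hx1 b hb)
  have hc : Y.toFinset.card ≤ 3 := by
    have := hcl (insert x1 Y.toFinset) (by simpa using c1)
    rw [Finset.card_insert_of_notMem (by simpa using n1)] at this
    omega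
  have hbig : ∀ x, H.Adj x1 x → x ∉ Y → Y.toFinset.card = 3 →
      ∃ y ∈ Y.toFinset, ¬ H.Adj x y := by
    intro x hx hxY h3
    by_contra hne
    push Not at hne
    have c2 : H.IsClique (insert x (insert x1 Y)) := c1.insert (by
      intro b hb _
      rcases hb with rfl | hb
      · exact hx.symm
      · exact hne b (by simpa using hb))
    have := hcl (insert x (insert x1 Y.toFinset)) (by simpa using c2)
    rw [Finset.card_insert_of_notMem (by simpa using ⟨hx.ne', hxY⟩),
      Finset.card_insert_of_notMem (by simpa using n1)] at this
    omega
  obtain ⟨f, finj, f2, f0⟩ := three_labels Y.toFinset hc (H.Adj x2) (H.Adj x3)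
    (hbig x2 a12 n2) (hbig x3 a13 n3) (by
      intro y hy z hz py qy pz qz
      by_contra hyz
      have hy : y ∈ Y := by simpa using hy
      have hz : z ∈ Y := by simpa using hz
      have hh := hcl {x1, x2, x3, y, z} (by
        have := hx1 y hy
        have := hx1 z hz
        have := hY hy hz hyz
        simp only [Finset.coe_insert, Finset.coe_singleton, SimpleGraph.isClique_insert,
          SimpleGraph.isClique_singleton, Set.mem_insert_iff, Set.mem_singleton_iff]
        grind)
      rw [Finset.card_insert_of_notMem, Finset.card_insert_of_notMem,
        Finset.card_insert_of_notMem, Finset.card_pair hyz] at hh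
      · omega
      all_goals
        simp only [Finset.mem_insert, Finset.mem_singleton]
        grind)
  simp only [Set.mem_toFinset] at finj f2 f0
  have hB : ∀ i : Fin 3, ∃ B : Finset ℕ, 4 ≤ B.card ∧ ∀ y ∈ Y, f y = i → B = L y := by
    intro i
    by_cases h : ∃ y ∈ Y, f y = i
    · obtain ⟨y, hy, rfl⟩ := h
      exact ⟨L y, hLY y hy, fun z hz e => by rw [finj z hz y hy e]⟩
    · exact ⟨Finset.range 4, by simp, fun y hy e => absurd ⟨y, hy, e⟩ h⟩
  choose B hB4 hBL using hB
  obtain ⟨p1, m1, p2, m2, p3, m3, b, hb, e12, e13, e23, binj, e1, e2, e3⟩ :=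
    core_lists (L x1) (L x2) (L x3) B hL1 hL2 hL3 hB4
  refine ⟨fun v => if v = x1 then p1 else if v = x2 then p2 else if v = x3 then p3 else b (f v),
    ?_, ?_⟩
  · intro v
    have := fun hv : v ∈ Y => hBL (f v) v hv rfl
    have := hb (f v)
    have := cov v
    grind
  · intro u w huw
    have hne := huw.ne
    have hsym := huw.symm
    have i1 := @binj (f u) (f w)
    have := cov u
    have := cov w
    have := finj u
    have := e1 (f u)
    have := e1 (f w)
    have := e2 (f u)
    have := e2 (f w)
    have := e3 (f u)
    have := e3 (f w)
    have := f2 u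
    have := f2 w
    have := f0 u
    have := f0 w
    clear hbig hcl finj f2 f0 hLY hBL hb e1 e2 e3 binj hB4 cov
    grind
end
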